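/- arXiv:1612.05246 — 3 statements merged into one kernel-verified Lean document; each statement's English description precedes it below -/
import Mathlib

section
/- Let q be a prime power. The number A_8(q) of ordered strong realizations of the Möbius–Kantor configuration in ℙ²(F_q) equals 840·b(q)·(q^2+q+1)(q^2+q)q^2(q-1)^2, where b(q) = #{x ∈ F_q : x² + x + 1 = 0}. -/
/-- Three points of the Desarguesian projective plane `ℙ²(F)` are collinear
iff representative vectors are linearly dependent. -/
def P2Collinear (F : Type) [Field F]
    (x y z : Projectivization F (Fin 3 → F)) : Prop :=
  ¬ Projectivization.Independent ![x, y, z]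

/-- The number of ordered `n`-arcs of `ℙ²(F)`: `n`-tuples of distinct points,
no three collinear. -/
noncomputable def P2nArcs (F : Type) [Field F] (n : ℕ) : ℕ :=
  Nat.card {p : Fin n → Projectivization F (Fin 3 → F) // Function.Injective p ∧
    ∀ i j k : Fin n, i ≠ j → i ≠ k → j ≠ k → ¬ P2Collinear F (p i) (p j) (p k)}

/-- The number of ordered strong realizations of the Möbius–Kantor
configuration in `ℙ²(F)`. -/
noncomputable def P2A8 (F : Type) [Field F] : ℕ :=
  Nat.card {p : ZMod 8 → Projectivization F (Fin 3 → F) // Function.Injective p ∧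
    ∃ σ : Equiv.Perm (ZMod 8), ∀ i j k : ZMod 8, i ≠ j → i ≠ k → j ≠ k →
      (P2Collinear F (p (σ i)) (p (σ j)) (p (σ k)) ↔
        ∃ a : ZMod 8, ({i, j, k} : Set (ZMod 8)) = {a, a + 1, a + 3})}

lemma zmod_eight_cases (i : ZMod 8) :
    i = 0 ∨ i = 1 ∨ i = 2 ∨ i = 3 ∨ i = 4 ∨ i = 5 ∨ i = 6 ∨ i = 7 := by
  revert i; decide

/-- The third point of the Möbius–Kantor line through two points; an antipodal pair `(i, i + 4)`,
which lies on no line, is sent to `i + 4`. -/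
def mkThird (i j : ZMod 8) : ZMod 8 :=
  i + (![0, 3, 7, 1, 4, 6, 5, 2] : Fin 8 → ZMod 8) (j - i)

/-- The map on the Möbius–Kantor points sending `0, 1` to `a, b` and compatible with the third
point operation. -/
def mkExtend (a b : ZMod 8) : ZMod 8 → ZMod 8 :=
  (![a, b, mkThird b (a + 4), mkThird a b, a + 4, b + 4, mkThird a (b + 4), mkThird a b + 4] :
    Fin 8 → ZMod 8)

lemma exists_line_iff (i j k : ZMod 8) (hij : i ≠ j) (hik : i ≠ k) (hjk : j ≠ k) :
    (∃ a : ZMod 8, ({i, j, k} : Set (ZMod 8)) = {a, a + 1, a + 3}) ↔ k = mkThird i j := by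
  have h : ∀ i j k : ZMod 8, i ≠ j → i ≠ k → j ≠ k →
      ((∃ a : ZMod 8, ({i, j, k} : Finset (ZMod 8)) = {a, a + 1, a + 3}) ↔
        k = mkThird i j) := by
    decide +kernel
  rw [← h i j k hij hik hjk]
  simp [← Finset.coe_inj]

/-- A permutation of `ZMod 8` is an automorphism of the Möbius–Kantor configuration. -/
def IsMKAut (τ : Equiv.Perm (ZMod 8)) : Prop :=
  ∀ i j k : ZMod 8, i ≠ j → i ≠ k → j ≠ k →
    (τ k = mkThird (τ i) (τ j) ↔ k = mkThird i j)

lemma IsMKAut.map_third {τ : Equiv.Perm (ZMod 8)} (h : IsMKAut τ) (i j : ZMod 8) (hij : i ≠ j) :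
    τ (mkThird i j) = mkThird (τ i) (τ j) := by
  have hne : ∀ i j : ZMod 8, i ≠ j → mkThird i j ≠ i := by decide +kernel
  obtain ⟨k, hk⟩ := τ.surjective (mkThird (τ i) (τ j))
  have hki : k ≠ i := by
    rintro rfl
    exact hne _ _ (τ.injective.ne hij) hk.symm
  by_cases hkj : k = j
  · subst hkj
    by_contra hcon
    have hk' : mkThird i k ≠ k := fun e => hcon (by rw [e]; exact hk)
    exact hcon ((h i k (mkThird i k) hij (hne i k hij).symm hk'.symm).2 rfl)
  · rw [← hk, ← (h i j k hij hki.symm (Ne.symm hkj)).1 hk]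

lemma IsMKAut.map_antipode {τ : Equiv.Perm (ZMod 8)} (h : IsMKAut τ) (i : ZMod 8) :
    τ (i + 4) = τ i + 4 := by
  have h4 : ∀ i : ZMod 8, i ≠ i + 4 ∧ mkThird i (i + 4) = i + 4 := by decide +kernel
  have hu : ∀ i j : ZMod 8, i ≠ j → mkThird i j = j → j = i + 4 := by decide +kernel
  refine hu _ _ (τ.injective.ne (h4 i).1) ?_
  rw [← h.map_third _ _ (h4 i).1, (h4 i).2]

lemma IsMKAut.eq_extend {τ : Equiv.Perm (ZMod 8)} (h : IsMKAut τ) :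
    ⇑τ = mkExtend (τ 0) (τ 1) := by
  have h4 : τ 4 = τ 0 + 4 := h.map_antipode 0
  have h5 : τ 5 = τ 1 + 4 := h.map_antipode 1
  have h3 : τ 3 = mkThird (τ 0) (τ 1) := h.map_third 0 1 (by decide)
  have h7 : τ 7 = τ 3 + 4 := h.map_antipode 3
  have h2 : τ 2 = mkThird (τ 1) (τ 4) := h.map_third 1 4 (by decide)
  have h6 : τ 6 = mkThird (τ 0) (τ 5) := h.map_third 0 5 (by decide)
  funext i
  rcases zmod_eight_cases i with rfl | rfl | rfl | rfl | rfl | rfl | rfl | rfl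
  · rfl
  · rfl
  · rw [h2, h4]; rfl
  · rw [h3]; rfl
  · rw [h4]; rfl
  · rw [h5]; rfl
  · rw [h6, h5]; rfl
  · rw [h7, h3]; rfl

lemma card_isMKAut : Nat.card {τ : Equiv.Perm (ZMod 8) // IsMKAut τ} = 48 := by
  have hcard : Nat.card {x : ZMod 8 × ZMod 8 // x.1 ≠ x.2 ∧ x.2 ≠ x.1 + 4} = 48 := by
    rw [Nat.card_eq_fintype_card]
    decide +kernel
  rw [← hcard]
  refine Nat.card_congr (Equiv.ofBijective
    (fun τ => ⟨(τ.1 0, τ.1 1), τ.1.injective.ne (by decide), ?_⟩) ⟨?_, ?_⟩)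
  · rw [← τ.2.map_antipode]
    exact τ.1.injective.ne (by decide)
  · rintro ⟨τ, hτ⟩ ⟨τ', hτ'⟩ h
    simp only [Subtype.mk.injEq, Prod.mk.injEq] at h
    refine Subtype.ext (DFunLike.coe_injective ?_)
    change ⇑τ = ⇑τ'
    rw [hτ.eq_extend, hτ'.eq_extend, h.1, h.2]
  · rintro ⟨⟨a, b⟩, hab, hab'⟩
    have hinj : ∀ a b : ZMod 8, a ≠ b → b ≠ a + 4 →
        ∀ i j, mkExtend a b i = mkExtend a b j → i = j := by decide +kernel
    have hmap : ∀ a b : ZMod 8, a ≠ b → b ≠ a + 4 →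
        ∀ i j, mkExtend a b (mkThird i j) = mkThird (mkExtend a b i) (mkExtend a b j) := by
      decide +kernel
    have haut : ∀ i j k : ZMod 8,
        mkExtend a b k = mkThird (mkExtend a b i) (mkExtend a b j) ↔ k = mkThird i j := by
      intro i j k
      rw [← hmap a b hab hab']
      exact ⟨fun h => hinj a b hab hab' _ _ h, congrArg _⟩
    exact ⟨⟨Equiv.ofBijective (mkExtend a b)
      (Finite.injective_iff_bijective.1 fun i j => hinj a b hab hab' i j),
      fun i j k _ _ _ => haut i j k⟩, rfl⟩

section Realizations

variable {F : Type} [Field F]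

lemma p2Collinear_iff_det_rep (x y z : Projectivization F (Fin 3 → F)) :
    P2Collinear F x y z ↔ (Matrix.of ![x.rep, y.rep, z.rep]).det = 0 := by
  have h : Projectivization.rep ∘ ![x, y, z] = (Matrix.of ![x.rep, y.rep, z.rep]).row := by
    funext i
    fin_cases i <;> rfl
  rw [P2Collinear, Projectivization.independent_iff, h, Matrix.linearIndependent_rows_iff_isUnit,
    Matrix.isUnit_iff_isUnit_det, isUnit_iff_ne_zero, not_not]

lemma p2Collinear_mk_iff {u v w : Fin 3 → F} (hu : u ≠ 0) (hv : v ≠ 0) (hw : w ≠ 0) :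
    P2Collinear F (.mk F u hu) (.mk F v hv) (.mk F w hw) ↔ (Matrix.of ![u, v, w]).det = 0 := by
  obtain ⟨a, ha⟩ := Projectivization.exists_smul_eq_mk_rep F u hu
  obtain ⟨b, hb⟩ := Projectivization.exists_smul_eq_mk_rep F v hv
  obtain ⟨c, hc⟩ := Projectivization.exists_smul_eq_mk_rep F w hw
  have h : (Matrix.of ![a • u, b • v, c • w]).det =
      a * b * c * (Matrix.of ![u, v, w]).det := by
    simp [Matrix.det_fin_three, Units.smul_def]
    ring
  rw [p2Collinear_iff_det_rep, ← ha, ← hb, ← hc, h]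
  simp

lemma det_mulVec_rows (A : Matrix (Fin 3) (Fin 3) F) (u v w : Fin 3 → F) :
    (Matrix.of ![A.mulVec u, A.mulVec v, A.mulVec w]).det =
      A.det * (Matrix.of ![u, v, w]).det := by
  have h : Matrix.of ![A.mulVec u, A.mulVec v, A.mulVec w] =
      Matrix.of ![u, v, w] * A.transpose := by
    ext i j
    fin_cases i <;> simp [Matrix.mul_apply, Matrix.mulVec, dotProduct, mul_comm]
  rw [h, Matrix.det_mul, Matrix.det_transpose, mul_comm]

/-- A labelled strong realization of the Möbius–Kantor configuration. -/
def IsMKRealization (p : ZMod 8 → Projectivization F (Fin 3 → F)) : Prop :=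
  ∀ i j k : ZMod 8, i ≠ j → i ≠ k → j ≠ k →
    (P2Collinear F (p i) (p j) (p k) ↔ k = mkThird i j)

lemma IsMKRealization.injective {p : ZMod 8 → Projectivization F (Fin 3 → F)}
    (hp : IsMKRealization p) : Function.Injective p := by
  have h : ∀ i j : ZMod 8, i ≠ j → ∃ k, i ≠ k ∧ j ≠ k ∧ k ≠ mkThird i j := by decide +kernel
  intro i j hij
  by_contra hne
  obtain ⟨k, hik, hjk, hk⟩ := h i j hne
  refine hk ((hp i j k hne hik hjk).1 ?_)
  rw [p2Collinear_iff_det_rep, hij]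
  exact Matrix.det_zero_of_row_eq (i := 0) (j := 1) (by decide) rfl

/-- Normalized representatives of a Möbius–Kantor realization whose points `0, 1, 2, 5` form the
standard frame. -/
def mkVec (x : F) : ZMod 8 → Fin 3 → F :=
  (![![1, 0, 0], ![0, 1, 0], ![0, 0, 1], ![1, 1, 0], ![0, 1, -x], ![1, 1, 1], ![-x, 1, 1],
    ![-x, 0, 1]] : Fin 8 → Fin 3 → F)

lemma mkVec_ne_zero (x : F) (i : ZMod 8) : mkVec x i ≠ 0 := by
  intro h
  have h0 := congrFun h 0
  have h1 := congrFun h 1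
  have h2 := congrFun h 2
  rcases zmod_eight_cases i with rfl | rfl | rfl | rfl | rfl | rfl | rfl | rfl
  · exact one_ne_zero h0
  · exact one_ne_zero h1
  · exact one_ne_zero h2
  · exact one_ne_zero h0
  · exact one_ne_zero h1
  · exact one_ne_zero h0
  · exact one_ne_zero h1
  · exact one_ne_zero h2

lemma mkVec_apply (x : F) :
    mkVec x 0 = ![1, 0, 0] ∧ mkVec x 1 = ![0, 1, 0] ∧ mkVec x 2 = ![0, 0, 1] ∧
      mkVec x 3 = ![1, 1, 0] ∧ mkVec x 4 = ![0, 1, -x] ∧ mkVec x 5 = ![1, 1, 1] ∧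
      mkVec x 6 = ![-x, 1, 1] ∧ mkVec x 7 = ![-x, 0, 1] :=
  ⟨rfl, rfl, rfl, rfl, rfl, rfl, rfl, rfl⟩

lemma det_mkVec_of_lt {x : F} (hx : x ^ 2 + x + 1 = 0) (i j k : ZMod 8) (hij : i.val < j.val)
    (hjk : j.val < k.val) :
    (Matrix.of ![mkVec x i, mkVec x j, mkVec x k]).det = 0 ↔ k = mkThird i j := by
  obtain ⟨h0, h1, h2, h3, h4, h5, h6, h7⟩ := mkVec_apply x
  rw [Matrix.det_fin_three]
  rcases zmod_eight_cases i with rfl | rfl | rfl | rfl | rfl | rfl | rfl | rfl <;>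
  rcases zmod_eight_cases j with rfl | rfl | rfl | rfl | rfl | rfl | rfl | rfl <;>
  first
  | exact absurd hij (by decide)
  | rcases zmod_eight_cases k with rfl | rfl | rfl | rfl | rfl | rfl | rfl | rfl <;>
    first
    | exact absurd hjk (by decide)
    | constructor
      · intro h
        first
        | decide
        | exfalso
          clear hij hjk
          simp only [h0, h1, h2, h3, h4, h5, h6, h7, Matrix.of_apply, Matrix.cons_val] at h
          clear h0 h1 h2 h3 h4 h5 h6 h7
          grind
      · intro h
        first
        | exact absurd h (by decide)
        | clear hij hjk h
          simp only [h0, h1, h2, h3, h4, h5, h6, h7, Matrix.of_apply, Matrix.cons_val]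
          clear h0 h1 h2 h3 h4 h5 h6 h7
          grind

lemma det_mkVec_iff {x : F} (hx : x ^ 2 + x + 1 = 0) (i j k : ZMod 8) (hij : i ≠ j)
    (hik : i ≠ k) (hjk : j ≠ k) :
    (Matrix.of ![mkVec x i, mkVec x j, mkVec x k]).det = 0 ↔ k = mkThird i j := by
  have hsymm : ∀ i j k : ZMod 8, i ≠ j → i ≠ k → j ≠ k →
      ((k = mkThird i j ↔ k = mkThird j i) ∧ (k = mkThird i j ↔ j = mkThird i k)) := by
    decide +kernel
  have hd₁ : ∀ u v w : Fin 3 → F,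
      (Matrix.of ![u, v, w]).det = 0 ↔ (Matrix.of ![v, u, w]).det = 0 := by
    intro u v w
    rw [← neg_eq_zero]
    simp only [Matrix.det_fin_three, Matrix.of_apply, Matrix.cons_val]
    ring_nf
  have hd₂ : ∀ u v w : Fin 3 → F,
      (Matrix.of ![u, v, w]).det = 0 ↔ (Matrix.of ![u, w, v]).det = 0 := by
    intro u v w
    rw [← neg_eq_zero]
    simp only [Matrix.det_fin_three, Matrix.of_apply, Matrix.cons_val]
    ring_nf
  have hlt : ∀ i j k : ZMod 8, i.val < j.val → i ≠ k → j ≠ k →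
      ((Matrix.of ![mkVec x i, mkVec x j, mkVec x k]).det = 0 ↔ k = mkThird i j) := by
    intro i j k hij hik hjk
    have hij' : i ≠ j := fun h => hij.ne (congrArg _ h)
    rcases lt_or_gt_of_ne ((ZMod.val_injective 8).ne hjk) with h | h
    · exact det_mkVec_of_lt hx i j k hij h
    · rw [hd₂, (hsymm i j k hij' hik hjk).2]
      rcases lt_or_gt_of_ne ((ZMod.val_injective 8).ne hik) with h' | h'
      · exact det_mkVec_of_lt hx i k j h' h
      · rw [hd₁, (hsymm i k j hik hij' hjk.symm).1]
        exact det_mkVec_of_lt hx k i j h' hij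
  rcases lt_or_gt_of_ne ((ZMod.val_injective 8).ne hij) with h | h
  · exact hlt i j k h hik hjk
  · rw [hd₁, (hsymm i j k hij hik hjk).1]
    exact hlt j i k h hjk hik

lemma exists_normal_form {w : ZMod 8 → Fin 3 → F} (h0 : w 0 = ![1, 0, 0])
    (h1 : w 1 = ![0, 1, 0]) (h2 : w 2 = ![0, 0, 1])
    (hw : ∀ i j k : ZMod 8, i ≠ j → i ≠ k → j ≠ k →
      ((Matrix.of ![w i, w j, w k]).det = 0 ↔ k = mkThird i j)) :
    ∃ (c : Fin 3 → F) (x : F), (∀ i, c i ≠ 0) ∧ x ^ 2 + x + 1 = 0 ∧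
      ∀ i, ∃ a : F, w i = a • (c * mkVec x i) := by
  have pos (i j k : ZMod 8) (hij : i ≠ j) (hik : i ≠ k) (hjk : j ≠ k) (h : k = mkThird i j) :=
    (hw i j k hij hik hjk).2 h
  have neg (i j k : ZMod 8) (hij : i ≠ j) (hik : i ≠ k) (hjk : j ≠ k) (h : k ≠ mkThird i j) :=
    mt (hw i j k hij hik hjk).1 h
  have d013 := pos 0 1 3 (by decide) (by decide) (by decide) (by decide)
  have d124 := pos 1 2 4 (by decide) (by decide) (by decide) (by decide)
  have d235 := pos 2 3 5 (by decide) (by decide) (by decide) (by decide)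
  have d346 := pos 3 4 6 (by decide) (by decide) (by decide) (by decide)
  have d457 := pos 4 5 7 (by decide) (by decide) (by decide) (by decide)
  have d560 := pos 5 6 0 (by decide) (by decide) (by decide) (by decide)
  have d671 := pos 6 7 1 (by decide) (by decide) (by decide) (by decide)
  have d702 := pos 7 0 2 (by decide) (by decide) (by decide) (by decide)
  have n015 := neg 0 1 5 (by decide) (by decide) (by decide) (by decide)
  have n025 := neg 0 2 5 (by decide) (by decide) (by decide) (by decide)
  have n125 := neg 1 2 5 (by decide) (by decide) (by decide) (by decide)
  have n016 := neg 0 1 6 (by decide) (by decide) (by decide) (by decide)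
  have n126 := neg 1 2 6 (by decide) (by decide) (by decide) (by decide)
  have n123 := neg 1 2 3 (by decide) (by decide) (by decide) (by decide)
  have n024 := neg 0 2 4 (by decide) (by decide) (by decide) (by decide)
  have n017 := neg 0 1 7 (by decide) (by decide) (by decide) (by decide)
  simp only [Matrix.det_fin_three, h0, h1, h2, Matrix.of_apply, Matrix.cons_val]
    at d013 d124 d235 d346 d457 d560 d671 d702 n015 n025 n125 n016 n126 n123 n024 n017
  clear pos neg hw
  ring_nf
    at d013 d124 d235 d346 d457 d560 d671 d702 n015 n025 n125 n016 n126 n123 n024 n017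
  simp only [neg_eq_zero] at d013 d124 n015 n025 n125 n016 n126 n123 n024 n017 d702
  obtain ⟨x, hx⟩ : ∃ x, x * (w 6 2 * w 5 0) = -(w 6 0 * w 5 2) :=
    ⟨-(w 6 0 * w 5 2) / (w 6 2 * w 5 0), div_mul_cancel₀ _ (mul_ne_zero n016 n125)⟩
  obtain ⟨v0, v1, v2, v3, v4, v5, v6, v7⟩ := mkVec_apply x
  have h42 : w 4 2 * w 5 1 = - w 4 1 * w 5 2 * x := by
    grind
  refine ⟨w 5, x, ?_, ?_, fun i => ?_⟩
  · simp [Fin.forall_fin_succ, n015, n025, n125]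
  · grind
  · rcases zmod_eight_cases i with rfl | rfl | rfl | rfl | rfl | rfl | rfl | rfl
    · refine ⟨(w 5 0)⁻¹, ?_⟩
      ext j; fin_cases j <;> simp [h0, v0, n125]
    · refine ⟨(w 5 1)⁻¹, ?_⟩
      ext j; fin_cases j <;> simp [h1, v1, n025]
    · refine ⟨(w 5 2)⁻¹, ?_⟩
      ext j; fin_cases j <;> simp [h2, v2, n015]
    · refine ⟨w 3 0 / w 5 0, ?_⟩
      ext j; fin_cases j <;> simp [v3, d013] <;> field_simp
      linear_combination -d235
    · refine ⟨w 4 1 / w 5 1, ?_⟩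
      ext j; fin_cases j <;> simp [v4, d124] <;> field_simp
      linear_combination h42
    · refine ⟨1, ?_⟩
      ext j; fin_cases j <;> simp [v5]
    · refine ⟨w 6 2 / w 5 2, ?_⟩
      ext j; fin_cases j <;> simp [v6] <;> field_simp
      · linear_combination hx
      · linear_combination -d560
    · refine ⟨w 7 2 / w 5 2, ?_⟩
      ext j; fin_cases j <;> simp [v7, d702] <;> field_simp
      grind

lemma GL_mulVec_injective (A : GL (Fin 3) F) :
    Function.Injective (Matrix.mulVec (A : Matrix (Fin 3) (Fin 3) F)) :=
  Matrix.mulVec_injective_of_isUnit A.isUnit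

lemma GL_mulVec_mkVec_ne_zero (A : GL (Fin 3) F) (x : F) (i : ZMod 8) :
    (A : Matrix (Fin 3) (Fin 3) F).mulVec (mkVec x i) ≠ 0 := fun h =>
  mkVec_ne_zero x i (GL_mulVec_injective A (h.trans (Matrix.mulVec_zero _).symm))

/-- The image of the normalized realization with parameter `x` under an invertible matrix. -/
def mkRealize (A : GL (Fin 3) F) (x : F) : ZMod 8 → Projectivization F (Fin 3 → F) :=
  fun i => .mk F ((A : Matrix (Fin 3) (Fin 3) F).mulVec (mkVec x i))
    (GL_mulVec_mkVec_ne_zero A x i)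

lemma isMKRealization_mkRealize (A : GL (Fin 3) F) {x : F} (hx : x ^ 2 + x + 1 = 0) :
    IsMKRealization (mkRealize A x) := by
  intro i j k hij hik hjk
  have hA : (A : Matrix (Fin 3) (Fin 3) F).det ≠ 0 :=
    isUnit_iff_ne_zero.1 ((Matrix.isUnit_iff_isUnit_det _).1 A.isUnit)
  unfold mkRealize
  rw [p2Collinear_mk_iff, det_mulVec_rows, mul_eq_zero, or_iff_right hA,
    det_mkVec_iff hx i j k hij hik hjk]

lemma mkRealize_smul (c : Fˣ) (A : GL (Fin 3) F) (x : F) :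
    mkRealize (c • A) x = mkRealize A x := by
  funext i
  refine (Projectivization.mk_eq_mk_iff F _ _ _ _).2 ⟨c, ?_⟩
  rw [Units.val_smul, Matrix.smul_mulVec]

lemma mkRealize_eq_iff {A B : GL (Fin 3) F} {x y : F} :
    mkRealize A x = mkRealize B y ↔ x = y ∧ ∃ c : Fˣ, B = c • A := by
  constructor
  · intro h
    have hc : ∀ i, ∃ c : F, ((A⁻¹ * B : GL (Fin 3) F) : Matrix (Fin 3) (Fin 3) F).mulVec
        (mkVec y i) = c • mkVec x i := by
      intro i
      obtain ⟨c, hc⟩ := (Projectivization.mk_eq_mk_iff F _ _ _ _).1 (congrFun h i).symm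
      refine ⟨c, ?_⟩
      rw [Units.val_mul, ← Matrix.mulVec_mulVec, ← hc, Units.smul_def, Matrix.mulVec_smul,
        Matrix.mulVec_mulVec, ← Units.val_mul, inv_mul_cancel, Units.val_one, Matrix.one_mulVec]
    set C : GL (Fin 3) F := A⁻¹ * B with hC
    have hB : B = A * C := by simp [hC]
    obtain ⟨c0, h0⟩ := hc 0
    obtain ⟨c1, h1⟩ := hc 1
    obtain ⟨c2, h2⟩ := hc 2
    obtain ⟨c5, h5⟩ := hc 5
    obtain ⟨c6, h6⟩ := hc 6
    obtain ⟨v0, v1, v2, -, -, v5, v6, -⟩ := mkVec_apply x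
    obtain ⟨w0, w1, w2, -, -, w5, w6, -⟩ := mkVec_apply y
    rw [v0, w0] at h0
    rw [v1, w1] at h1
    rw [v2, w2] at h2
    rw [v5, w5] at h5
    rw [v6, w6] at h6
    simp only [funext_iff, Fin.forall_fin_succ, Matrix.mulVec, dotProduct, Fin.sum_univ_succ]
      at h0 h1 h2 h5 h6
    simp at h0 h1 h2 h5 h6
    obtain ⟨-, h10, h20⟩ := h0
    obtain ⟨h01, -, h21⟩ := h1
    obtain ⟨h02, h12, -⟩ := h2
    simp only [h01, h02, h10, h12, h20, h21, zero_add, add_zero, zero_mul, neg_zero] at h5 h6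
    obtain ⟨h00, h11, h22⟩ := h5
    have hCdiag : (C : Matrix (Fin 3) (Fin 3) F) = c5 • 1 := by
      ext i j
      fin_cases i <;> fin_cases j <;>
        simp [h00, h01, h02, h10, h11, h12, h20, h21, h22]
    have hc5 : c5 ≠ 0 := by
      rintro rfl
      exact C.ne_zero (by rw [hCdiag, zero_smul])
    refine ⟨mul_left_cancel₀ hc5 ?_, Units.mk0 c5 hc5, ?_⟩
    · linear_combination h00 * y - x * h11 + x * h6.2.1 + h6.1
    · rw [hB]
      ext1
      rw [Units.val_mul, hCdiag, Units.val_smul, Matrix.mul_smul, mul_one]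
      rfl
  · rintro ⟨rfl, c, rfl⟩
    rw [mkRealize_smul]

lemma exists_mkRealize_eq {p : ZMod 8 → Projectivization F (Fin 3 → F)}
    (hp : IsMKRealization p) :
    ∃ (A : GL (Fin 3) F) (x : F), x ^ 2 + x + 1 = 0 ∧ mkRealize A x = p := by
  have hdet (i j k : ZMod 8) (hij : i ≠ j) (hik : i ≠ k) (hjk : j ≠ k) :=
    (p2Collinear_iff_det_rep _ _ _).symm.trans (hp i j k hij hik hjk)
  let U : Matrix (Fin 3) (Fin 3) F := (Matrix.of ![(p 0).rep, (p 1).rep, (p 2).rep]).transpose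
  have hU : U.det ≠ 0 := by
    rw [Matrix.det_transpose, Ne, hdet 0 1 2 (by decide) (by decide) (by decide)]
    decide
  let U' : GL (Fin 3) F := Matrix.GeneralLinearGroup.mkOfDetNeZero U hU
  let w (i : ZMod 8) : Fin 3 → F := (U'⁻¹ : GL (Fin 3) F).1.mulVec (p i).rep
  have hUw (i : ZMod 8) : U.mulVec (w i) = (p i).rep := by
    change U'.1.mulVec ((U'⁻¹ : GL (Fin 3) F).1.mulVec (p i).rep) = _
    rw [Matrix.mulVec_mulVec, ← Units.val_mul, mul_inv_cancel, Units.val_one, Matrix.one_mulVec]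
  have hw (i j k : ZMod 8) (hij : i ≠ j) (hik : i ≠ k) (hjk : j ≠ k) :
      (Matrix.of ![w i, w j, w k]).det = 0 ↔ k = mkThird i j := by
    have h := det_mulVec_rows U (w i) (w j) (w k)
    rw [hUw, hUw, hUw] at h
    rw [← hdet i j k hij hik hjk, h, mul_eq_zero, or_iff_right hU]
  have hinj : Function.Injective U.mulVec := GL_mulVec_injective U'
  have hw0 : w 0 = ![1, 0, 0] := hinj <| by
    rw [hUw]
    ext i
    fin_cases i <;> simp [U, Matrix.mulVec, dotProduct, Fin.sum_univ_succ]
  have hw1 : w 1 = ![0, 1, 0] := hinj <| by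
    rw [hUw]
    ext i
    fin_cases i <;> simp [U, Matrix.mulVec, dotProduct, Fin.sum_univ_succ]
  have hw2 : w 2 = ![0, 0, 1] := hinj <| by
    rw [hUw]
    ext i
    fin_cases i <;> simp [U, Matrix.mulVec, dotProduct, Fin.sum_univ_succ]
  obtain ⟨c, x, hc, hx, ha⟩ := exists_normal_form hw0 hw1 hw2 hw
  have hA : (U * Matrix.diagonal c).det ≠ 0 := by
    rw [Matrix.det_mul, Matrix.det_diagonal]
    exact mul_ne_zero hU (Finset.prod_ne_zero_iff.2 fun i _ => hc i)
  refine ⟨Matrix.GeneralLinearGroup.mkOfDetNeZero _ hA, x, hx, funext fun i => ?_⟩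
  obtain ⟨a, hi⟩ := ha i
  rw [← Projectivization.mk_rep (p i)]
  refine ((Projectivization.mk_eq_mk_iff' F _ _ _ _).2 ⟨a, ?_⟩).symm
  change a • (U * Matrix.diagonal c).mulVec (mkVec x i) = (p i).rep
  have hd : (Matrix.diagonal c).mulVec (mkVec x i) = c * mkVec x i :=
    funext fun j => Matrix.mulVec_diagonal _ _ _
  rw [← hUw i, hi, ← Matrix.mulVec_mulVec, hd, Matrix.mulVec_smul]


lemma card_realizations_mul :
    Nat.card {p : ZMod 8 → Projectivization F (Fin 3 → F) // IsMKRealization p} * Nat.card Fˣ =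
      Nat.card (GL (Fin 3) F) * Nat.card {x : F // x ^ 2 + x + 1 = 0} := by
  choose! A x hx hAx using fun p : ZMod 8 → Projectivization F (Fin 3 → F) =>
    exists_mkRealize_eq (p := p)
  rw [← Nat.card_prod, ← Nat.card_prod]
  refine Nat.card_congr (Equiv.ofBijective
    (fun pc => (pc.2 • A pc.1.1, ⟨x pc.1.1, hx _ pc.1.2⟩)) ⟨?_, ?_⟩)
  · rintro ⟨⟨p, hp⟩, c⟩ ⟨⟨p', hp'⟩, c'⟩ h
    simp only [Prod.mk.injEq, Subtype.mk.injEq] at h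
    have hpp : p = p' := by
      rw [← hAx p hp, ← hAx p' hp', ← mkRealize_smul c, ← mkRealize_smul c' (A p'), h.1, h.2]
    subst hpp
    have hcc : c = c' := by
      have h1 := congrArg Units.val h.1
      rw [Units.val_smul, Units.val_smul] at h1
      exact Units.ext (smul_left_injective F (A p).ne_zero h1)
    rw [hcc]
  · rintro ⟨B, y, hy⟩
    have hp := isMKRealization_mkRealize B hy
    obtain ⟨hxy, c, hB⟩ := mkRealize_eq_iff.1 (hAx _ hp)
    exact ⟨(⟨_, hp⟩, c), Prod.ext hB.symm (Subtype.ext hxy)⟩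

lemma P2A8_mul :
    48 * P2A8 F = Nat.factorial 8 *
      Nat.card {p : ZMod 8 → Projectivization F (Fin 3 → F) // IsMKRealization p} := by
  have hiff (p : ZMod 8 → Projectivization F (Fin 3 → F)) (σ : Equiv.Perm (ZMod 8)) :
      (∀ i j k : ZMod 8, i ≠ j → i ≠ k → j ≠ k →
        (P2Collinear F (p (σ i)) (p (σ j)) (p (σ k)) ↔
          ∃ a : ZMod 8, ({i, j, k} : Set (ZMod 8)) = {a, a + 1, a + 3})) ↔
      IsMKRealization (p ∘ σ) :=
    forall₃_congr fun i j k => forall₃_congr fun hij hik hjk => by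
      rw [exists_line_iff i j k hij hik hjk]
      rfl
  have haut (p : ZMod 8 → Projectivization F (Fin 3 → F)) (hp : IsMKRealization p)
      (τ : Equiv.Perm (ZMod 8)) : IsMKRealization (p ∘ τ) ↔ IsMKAut τ :=
    forall₃_congr fun i j k => forall₃_congr fun hij hik hjk => by
      rw [← hp _ _ _ (τ.injective.ne hij) (τ.injective.ne hik) (τ.injective.ne hjk)]
      rfl
  have hS : P2A8 F = Nat.card {p : ZMod 8 → Projectivization F (Fin 3 → F) //
      ∃ σ : Equiv.Perm (ZMod 8), IsMKRealization (p ∘ σ)} := by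
    refine Nat.card_congr (Equiv.subtypeEquivRight fun p => ?_)
    simp only [hiff]
    refine and_iff_right_of_imp ?_
    rintro ⟨σ, hσ⟩
    exact (σ.injective_comp p).1 hσ.injective
  choose! σ hσ using fun (p : ZMod 8 → Projectivization F (Fin 3 → F))
    (h : ∃ σ : Equiv.Perm (ZMod 8), IsMKRealization (p ∘ σ)) => h
  have hperm : Nat.card (Equiv.Perm (ZMod 8)) = Nat.factorial 8 := by
    rw [Nat.card_perm, Nat.card_zmod]
  rw [hS, ← card_isMKAut, ← hperm, ← Nat.card_prod, ← Nat.card_prod]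
  refine Nat.card_congr (Equiv.ofBijective
    (fun x => (σ x.2.1 * x.1.1, ⟨x.2.1 ∘ ⇑(σ x.2.1 * x.1.1),
      (haut _ (hσ _ x.2.2) _).2 x.1.2⟩)) ⟨?_, ?_⟩)
  · rintro ⟨⟨τ, hτ⟩, p, hp⟩ ⟨⟨τ', hτ'⟩, p', hp'⟩ h
    have h1 : σ p * τ = σ p' * τ' := congrArg Prod.fst h
    have h2 : p ∘ ⇑(σ p * τ) = p' ∘ ⇑(σ p' * τ') := congrArg (fun x => x.2.1) h
    rw [h1] at h2
    have hpp : p = p' := (Equiv.surjective _).injective_comp_right h2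
    subst hpp
    have hττ : τ = τ' := mul_left_cancel h1
    subst hττ
    rfl
  · rintro ⟨ρ, p, hp⟩
    have hs : ∃ σ : Equiv.Perm (ZMod 8), IsMKRealization ((p ∘ ⇑ρ.symm) ∘ ⇑σ) :=
      ⟨ρ, by simpa [Function.comp_assoc] using hp⟩
    have hmul : σ (p ∘ ⇑ρ.symm) * ((σ (p ∘ ⇑ρ.symm))⁻¹ * ρ) = ρ := mul_inv_cancel_left _ _
    refine ⟨(⟨(σ (p ∘ ⇑ρ.symm))⁻¹ * ρ, (haut _ (hσ _ hs) _).1 ?_⟩, ⟨p ∘ ⇑ρ.symm, hs⟩), ?_⟩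
    · rw [Function.comp_assoc, ← Equiv.Perm.coe_mul, hmul]
      simpa [Function.comp_assoc] using hp
    · refine Prod.ext hmul (Subtype.ext ?_)
      simp only [hmul]
      simp [Function.comp_assoc]

end Realizations

/-- The number of ordered strong realizations of the Möbius–Kantor
configuration in `ℙ²(F_q)` is `840·b(q)·(q²+q+1)(q²+q)q²(q-1)²`, where
`b(q) = #{x ∈ F_q : x² + x + 1 = 0}`. -/
theorem count_moebius_kantor_realizations (F : Type) [Field F] [Fintype F]
    (q b : ℤ) (hq : q = Fintype.card F)
    (hb : b = Nat.card {x : F // x ^ 2 + x + 1 = 0}) :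
    (P2A8 F : ℤ) =
      840 * b * ((q ^ 2 + q + 1) * (q ^ 2 + q) * q ^ 2 * (q - 1) ^ 2) := by
  have hq1 : 1 < Fintype.card F := Fintype.one_lt_card
  have hunits : (Nat.card Fˣ : ℤ) = q - 1 := by
    rw [Nat.card_units, Nat.card_eq_fintype_card, hq]
    push_cast [Nat.cast_sub hq1.le]
    rfl
  have hGL : (Nat.card (GL (Fin 3) F) : ℤ) = (q ^ 3 - 1) * (q ^ 3 - q) * (q ^ 3 - q ^ 2) := by
    have hle (n : ℕ) (hn : n ≤ 3) : Fintype.card F ^ n ≤ Fintype.card F ^ 3 :=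
      Nat.pow_le_pow_right (by omega) hn
    rw [Matrix.card_GL_field, Fin.prod_univ_three, Nat.cast_mul, Nat.cast_mul,
      Nat.cast_sub (hle _ (by decide)), Nat.cast_sub (hle _ (by decide)),
      Nat.cast_sub (hle _ (by decide)), hq]
    simp
  have h1 := congrArg (Nat.cast : ℕ → ℤ) (P2A8_mul (F := F))
  have h2 := congrArg (Nat.cast : ℕ → ℤ) (card_realizations_mul (F := F))
  push_cast at h1 h2
  rw [hunits, hGL, ← hb] at h2
  have hf : (Nat.factorial 8 : ℤ) = 40320 := by norm_num [Nat.factorial]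
  rw [hf] at h1
  have hq' : q - 1 ≠ 0 := by
    rw [hq]
    omega
  refine mul_left_cancel₀ (mul_ne_zero (show (48 : ℤ) ≠ 0 by norm_num) hq') ?_
  linear_combination (q - 1) * h1 + 40320 * h2
end

section
/- Let q be a prime power. The number A_{9_3}(q) of ordered strong realizations of the Pappus configuration in ℙ²(F_q) equals 3360·((q − 2 − b(q))(q − 5) + (q − 3)·b(q))·(q^2+q+1)(q^2+q)q^2(q-1)^2, where b(q) = #{x ∈ F_q : x² + x + 1 = 0}. -/
/-- The nine lines of the Pappus configuration on point set `{0, …, 8}`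
(corresponding to `{1, …, 9}` shifted down by one). -/
def pappusLines : Set (Set (Fin 9)) :=
  {{0, 1, 2}, {3, 4, 5}, {6, 7, 8}, {0, 4, 8}, {1, 5, 6}, {2, 3, 7},
    {0, 5, 7}, {1, 3, 8}, {2, 4, 6}}

/-- The number of ordered strong realizations of the Pappus configuration
in `ℙ²(F)`. -/
noncomputable def P2Pappus (F : Type) [Field F] : ℕ :=
  Nat.card {p : Fin 9 → Projectivization F (Fin 3 → F) // Function.Injective p ∧
    ∃ σ : Equiv.Perm (Fin 9), ∀ i j k : Fin 9, i ≠ j → i ≠ k → j ≠ k →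
      (P2Collinear F (p (σ i)) (p (σ j)) (p (σ k)) ↔
        ({i, j, k} : Set (Fin 9)) ∈ pappusLines)}

/-- The permutations of `ι` that preserve a ternary relation on distinct triples. -/
def tripleAut {ι : Type*} (L : ι → ι → ι → Prop) : Set (Equiv.Perm ι) :=
  {τ | ∀ i j k, i ≠ j → i ≠ k → j ≠ k → (L (τ i) (τ j) (τ k) ↔ L i j k)}

/-- The labelings `p` of points of `P` whose collinear triples are exactly those given by `L`. -/
def strongRealizations {ι P : Type*} (C : P → P → P → Prop) (L : ι → ι → ι → Prop) :
    Set (ι → P) :=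
  {p | ∀ i j k, i ≠ j → i ≠ k → j ≠ k → (C (p i) (p j) (p k) ↔ L i j k)}

theorem card_relabelings_mul_card_tripleAut {ι P : Type*} (C : P → P → P → Prop)
    (L : ι → ι → ι → Prop) :
    Nat.card {p : ι → P // ∃ σ : Equiv.Perm ι, p ∘ σ ∈ strongRealizations C L} *
      Nat.card (tripleAut L) =
    Nat.card (strongRealizations C L) * Nat.card (Equiv.Perm ι) := by
  classical
  rw [← Nat.card_prod, ← Nat.card_prod]
  have aux : ∀ (t : ι → P) (σ ρ : Equiv.Perm ι), t ∘ σ ∈ strongRealizations C L →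
      (t ∘ ρ ∈ strongRealizations C L ↔ σ⁻¹ * ρ ∈ tripleAut L) := by
    intro t σ ρ hσ
    refine forall₃_congr fun i j k => forall₃_congr fun hij hik hjk => ?_
    have h := hσ ((σ⁻¹ * ρ) i) ((σ⁻¹ * ρ) j) ((σ⁻¹ * ρ) k)
      ((σ⁻¹ * ρ).injective.ne hij) ((σ⁻¹ * ρ).injective.ne hik) ((σ⁻¹ * ρ).injective.ne hjk)
    rw [← h]
    simp
  choose s hs using fun t : {p : ι → P // ∃ σ : Equiv.Perm ι, p ∘ σ ∈ strongRealizations C L} =>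
    t.2
  refine Nat.card_eq_of_bijective (fun x => (⟨x.1.1 ∘ (s x.1 * x.2.1 : Equiv.Perm ι),
    (aux _ _ _ (hs x.1)).2 (by simp)⟩, s x.1 * x.2.1)) ⟨?_, ?_⟩
  · rintro ⟨t, τ⟩ ⟨t', τ'⟩ h
    obtain ⟨h1, h2⟩ := Prod.mk.inj h
    have h3 := congrArg Subtype.val h1
    simp only [h2] at h3
    obtain rfl : t = t' := Subtype.ext ((s t' * τ'.1).surjective.injective_comp_right h3)
    simpa [Subtype.ext_iff] using h2
  · rintro ⟨⟨p, hp⟩, σ⟩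
    have hpσ : (p ∘ (σ⁻¹ : Equiv.Perm ι)) ∘ σ = p := by ext; simp
    have ht : ∃ ρ : Equiv.Perm ι,
        (p ∘ (σ⁻¹ : Equiv.Perm ι)) ∘ ρ ∈ strongRealizations C L := ⟨σ, by rwa [hpσ]⟩
    refine ⟨(⟨_, ht⟩, ⟨(s ⟨_, ht⟩)⁻¹ * σ, (aux _ _ _ (hs ⟨_, ht⟩)).1 (by rwa [hpσ])⟩), ?_⟩
    simp only [mul_inv_cancel_left, hpσ]

theorem card_tripleAut_congr {ι κ : Type*} (e : ι ≃ κ) {L : ι → ι → ι → Prop}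
    {L' : κ → κ → κ → Prop}
    (h : ∀ i j k, i ≠ j → i ≠ k → j ≠ k → (L i j k ↔ L' (e i) (e j) (e k))) :
    Nat.card (tripleAut L) = Nat.card (tripleAut L') := by
  refine Nat.card_congr (e.permCongr.subtypeEquiv fun τ => ?_)
  refine e.forall_congr fun i => e.forall_congr fun j => e.forall_congr fun k => ?_
  simp only [ne_eq, EmbeddingLike.apply_eq_iff_eq]
  refine forall₃_congr fun hij hik hjk => ?_
  rw [← h i j k hij hik hjk, h (τ i) (τ j) (τ k) (τ.injective.ne hij) (τ.injective.ne hik)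
    (τ.injective.ne hjk)]
  simp [Equiv.permCongr_apply]

/-- The Pappus configuration as the affine plane over `ZMod 3` without a parallel class of
lines. -/
def affinePappus (u v w : ZMod 3 × ZMod 3) : Prop :=
  u + v + w = 0 ∧ ¬ (u.2 = v.2 ∧ u.2 = w.2)

theorem affinePappus_third {u v : ZMod 3 × ZMod 3} (h : u.2 ≠ v.2) :
    u ≠ v ∧ u ≠ -(u + v) ∧ v ≠ -(u + v) ∧ affinePappus u v (-(u + v)) := by
  unfold affinePappus
  revert u v
  decide

theorem tripleAut_third {σ : Equiv.Perm (ZMod 3 × ZMod 3)} (hσ : σ ∈ tripleAut affinePappus)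
    {u v : ZMod 3 × ZMod 3} (h : u.2 ≠ v.2) : σ (-(u + v)) = -(σ u + σ v) := by
  obtain ⟨h1, h2, h3, h4⟩ := affinePappus_third h
  exact (neg_eq_of_add_eq_zero_right ((hσ _ _ _ h1 h2 h3).2 h4).1).symm

theorem tripleAut_snd_eq_iff {σ : Equiv.Perm (ZMod 3 × ZMod 3)}
    (hσ : σ ∈ tripleAut affinePappus) (u v : ZMod 3 × ZMod 3) :
    (σ u).2 = (σ v).2 ↔ u.2 = v.2 := by
  have key : ∀ τ ∈ tripleAut affinePappus, ∀ u v : ZMod 3 × ZMod 3,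
      u.2 ≠ v.2 → (τ u).2 ≠ (τ v).2 := by
    intro τ hτ u v huv h
    obtain ⟨h1, h2, h3, h4⟩ := affinePappus_third huv
    obtain ⟨h5, h6⟩ := (hτ _ _ _ h1 h2 h3).2 h4
    refine h6 ⟨h, ?_⟩
    have h7 := congrArg Prod.snd h5
    simp only [Prod.snd_add, Prod.snd_zero] at h7
    rw [← h] at h7
    generalize (τ u).2 = x at h7 ⊢
    generalize (τ (-(u + v))).2 = y at h7 ⊢
    revert x y
    decide
  refine not_iff_not.1 ⟨fun h h' => ?_, key σ hσ u v⟩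
  have hinv : σ⁻¹ ∈ tripleAut affinePappus := by
    intro i j k hij hik hjk
    have := hσ (σ⁻¹ i) (σ⁻¹ j) (σ⁻¹ k) (σ⁻¹.injective.ne hij) (σ⁻¹.injective.ne hik)
      (σ⁻¹.injective.ne hjk)
    simpa using this.symm
  exact key _ hinv _ _ h (by simpa using h')

theorem tripleAut_affinePappus_ext {σ τ : Equiv.Perm (ZMod 3 × ZMod 3)}
    (hσ : σ ∈ tripleAut affinePappus) (hτ : τ ∈ tripleAut affinePappus)
    (h00 : σ (0, 0) = τ (0, 0)) (h10 : σ (1, 0) = τ (1, 0)) (h01 : σ (0, 1) = τ (0, 1)) :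
    σ = τ := by
  have step : ∀ {u v : ZMod 3 × ZMod 3} (w), u.2 ≠ v.2 → -(u + v) = w → σ u = τ u →
      σ v = τ v → σ w = τ w := by
    rintro u v _ huv rfl hu hv
    rw [tripleAut_third hσ huv, tripleAut_third hτ huv, hu, hv]
  have h02 := step (0, 2) (by decide) (by decide) h00 h01
  have h22 := step (2, 2) (by decide) (by decide) h10 h01
  have h21 := step (2, 1) (by decide) (by decide) h10 h02
  have h11 := step (1, 1) (by decide) (by decide) h00 h22
  have h12 := step (1, 2) (by decide) (by decide) h00 h21
  have h20 := step (2, 0) (by decide) (by decide) h11 h02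
  ext1 ⟨x, y⟩
  fin_cases x <;> fin_cases y <;> assumption

theorem card_tripleAut_affinePappus : Nat.card (tripleAut affinePappus) = 108 := by
  let X := {x : (ZMod 3 × ZMod 3) × (ZMod 3 × ZMod 3) × (ZMod 3 × ZMod 3) //
    x.1 ≠ x.2.1 ∧ x.1.2 = x.2.1.2 ∧ x.1.2 ≠ x.2.2.2}
  have hX : Nat.card X = 108 := by
    rw [Nat.card_eq_fintype_card]
    decide +kernel
  rw [← hX]
  refine Nat.card_eq_of_bijective (fun σ => ⟨(σ.1 (0, 0), σ.1 (1, 0), σ.1 (0, 1)),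
    σ.1.injective.ne (by decide), (tripleAut_snd_eq_iff σ.2 _ _).2 rfl,
    (tripleAut_snd_eq_iff σ.2 _ _).not.2 (by decide)⟩) ⟨?_, ?_⟩
  · rintro ⟨σ, hσ⟩ ⟨τ, hτ⟩ h
    obtain ⟨h00, h⟩ := Prod.mk.inj (congrArg Subtype.val h)
    obtain ⟨h10, h01⟩ := Prod.mk.inj h
    exact Subtype.ext (tripleAut_affinePappus_ext hσ hτ h00 h10 h01)
  · rintro ⟨⟨⟨x1, x2⟩, ⟨y1, y2⟩, ⟨z1, z2⟩⟩, h1, h2, h3⟩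
    simp only at h1 h2 h3
    subst h2
    have h1 : y1 - x1 ≠ 0 := fun h => h1 (by rw [sub_eq_zero.1 h])
    have h3 : z2 - x2 ≠ 0 := fun h => h3 (sub_eq_zero.1 h).symm
    let σ : Equiv.Perm (ZMod 3 × ZMod 3) :=
      { toFun := fun u => (x1 + u.1 * (y1 - x1) + u.2 * (z1 - x1), x2 + u.2 * (z2 - x2))
        invFun := fun u => ((u.1 - x1 - (u.2 - x2) / (z2 - x2) * (z1 - x1)) / (y1 - x1),
          (u.2 - x2) / (z2 - x2))
        left_inv := fun u => by ext <;> simp <;> field_simp <;> ring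
        right_inv := fun u => by ext <;> (simp; field_simp; ring) }
    have h30 : (3 : ZMod 3) = 0 := rfl
    refine ⟨⟨σ, ?_⟩, ?_⟩
    · rintro ⟨i1, i2⟩ ⟨j1, j2⟩ ⟨k1, k2⟩ - - -
      have e2 : x2 + i2 * (z2 - x2) + (x2 + j2 * (z2 - x2)) + (x2 + k2 * (z2 - x2)) =
          (i2 + j2 + k2) * (z2 - x2) := by linear_combination x2 * h30
      have e1 : x1 + i1 * (y1 - x1) + i2 * (z1 - x1) + (x1 + j1 * (y1 - x1) + j2 * (z1 - x1))
          + (x1 + k1 * (y1 - x1) + k2 * (z1 - x1)) =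
          (i1 + j1 + k1) * (y1 - x1) + (i2 + j2 + k2) * (z1 - x1) := by
        linear_combination x1 * h30
      simp only [affinePappus, σ, Equiv.coe_fn_mk, Prod.mk_add_mk, Prod.mk_eq_zero, e1, e2,
        add_right_inj, mul_left_inj' h3, mul_eq_zero, h3, or_false]
      refine and_congr_left fun _ => and_congr_left fun h => ?_
      simp [h, h1]
    · ext <;> simp [σ]

/-- The parameters `(a, c)` of the nondegenerate Pappus configurations in `pappusVec`. -/
def PappusParam {F : Type*} [Field F] (a c : F) : Prop :=
  a ≠ 0 ∧ a ≠ 1 ∧ c ≠ 0 ∧ c ≠ 1 ∧ a * c ≠ 1 ∧ a + c ≠ 1 ∧ a + c ≠ a * c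

theorem card_pappusParam_left {F : Type*} [Field F] [Fintype F] [DecidableEq F] (c : F) :
    (Nat.card {a : F // PappusParam a c} : ℤ) =
      ((Fintype.card F : ℤ) - 5) - (if c = 0 then (Fintype.card F : ℤ) - 5 else 0) -
        (if c = 1 then (Fintype.card F : ℤ) - 5 else 0) +
        2 * (if c ^ 2 - c + 1 = 0 then 1 else 0) := by
  rcases eq_or_ne c 0 with rfl | h0
  · simp [PappusParam]
  rcases eq_or_ne c 1 with rfl | h1
  · simp [PappusParam]
  have h1' : c - 1 ≠ 0 := sub_ne_zero.2 h1
  have key : ∀ a : F, PappusParam a c ↔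
      a ∉ ({0, 1, c⁻¹, 1 - c, c / (c - 1)} : Finset F) := by
    intro a
    have e1 : a = c⁻¹ ↔ a * c = 1 := by
      rw [inv_eq_one_div, eq_div_iff h0]
    have e2 : a = 1 - c ↔ a + c = 1 := eq_sub_iff_add_eq
    have e3 : a = c / (c - 1) ↔ a + c = a * c := by
      rw [eq_div_iff h1']
      constructor <;> intro h <;> linear_combination -h
    simp only [Finset.mem_insert, Finset.mem_singleton, e1, e2, e3, PappusParam]
    tauto
  have hcard : (Nat.card {a : F // PappusParam a c} : ℤ) = (Fintype.card F : ℤ) -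
      (({0, 1, c⁻¹, 1 - c, c / (c - 1)} : Finset F).card : ℤ) := by
    rw [Nat.card_congr (Equiv.subtypeEquivRight key), Nat.card_eq_fintype_card,
      Fintype.card_subtype, eq_sub_iff_add_eq, ← Nat.cast_add,
      ← Finset.card_compl_add_card ({0, 1, c⁻¹, 1 - c, c / (c - 1)} : Finset F)]
    congr 3
    ext; simp
  have f1 : (0 : F) ≠ c⁻¹ := (inv_ne_zero h0).symm
  have f2 : (0 : F) ≠ 1 - c := (sub_ne_zero.2 h1.symm).symm
  have f3 : (0 : F) ≠ c / (c - 1) := (div_ne_zero h0 h1').symm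
  have f4 : (1 : F) ≠ c⁻¹ := fun h => h1 (inv_eq_one.1 h.symm)
  have f5 : (1 : F) ≠ 1 - c := fun h => h0 (by linear_combination h)
  have f6 : (1 : F) ≠ c / (c - 1) := fun h => by
    rw [eq_div_iff h1'] at h
    exact one_ne_zero (α := F) (by linear_combination -h)
  have g1 : c⁻¹ = 1 - c ↔ c ^ 2 - c + 1 = 0 := by
    rw [inv_eq_one_div, div_eq_iff h0]
    constructor <;> intro h <;> linear_combination h
  have g2 : c⁻¹ = c / (c - 1) ↔ c ^ 2 - c + 1 = 0 := by
    rw [eq_div_iff h1', inv_mul_eq_iff_eq_mul₀ h0]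
    constructor <;> intro h <;> linear_combination -h
  have g3 : 1 - c = c / (c - 1) ↔ c ^ 2 - c + 1 = 0 := by
    rw [eq_div_iff h1']
    constructor <;> intro h <;> linear_combination -h
  rw [hcard, if_neg h0, if_neg h1]
  by_cases h : c ^ 2 - c + 1 = 0
  · have : ({0, 1, c⁻¹, 1 - c, c / (c - 1)} : Finset F) = {0, 1, c⁻¹} := by
      rw [← g1.2 h, ← g2.2 h]; simp
    rw [this, if_pos h, Finset.card_insert_of_notMem (by simp [h0.symm]),
      Finset.card_insert_of_notMem (by simpa using f4), Finset.card_singleton]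
    push_cast; ring
  · rw [if_neg h, Finset.card_insert_of_notMem (by
        simp only [Finset.mem_insert, Finset.mem_singleton, zero_ne_one, f1, f2, f3,
          or_self, not_false_iff]),
      Finset.card_insert_of_notMem (by
        simp only [Finset.mem_insert, Finset.mem_singleton, f4, f5, f6, or_self, not_false_iff]),
      Finset.card_insert_of_notMem (by
        simp only [Finset.mem_insert, Finset.mem_singleton, g1, g2, h, or_self, not_false_iff]),
      Finset.card_insert_of_notMem (by simp only [Finset.mem_singleton, g3, h, not_false_iff]),
      Finset.card_singleton]
    push_cast; ring

theorem card_pappusParam (F : Type*) [Field F] [Fintype F] :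
    (Nat.card {x : F × F // PappusParam x.1 x.2} : ℤ) =
      ((Fintype.card F : ℤ) - 2) * ((Fintype.card F : ℤ) - 5) +
        2 * Nat.card {x : F // x ^ 2 + x + 1 = 0} := by
  classical
  have e : {x : F × F // PappusParam x.1 x.2} ≃ Σ c : F, {a : F // PappusParam a c} :=
    { toFun := fun x => ⟨x.1.2, x.1.1, x.2⟩
      invFun := fun y => ⟨(y.2.1, y.1), y.2.2⟩
      left_inv := fun _ => rfl
      right_inv := fun _ => rfl }
  have e' : {x : F // x ^ 2 + x + 1 = 0} ≃ {c : F // c ^ 2 - c + 1 = 0} :=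
    (Equiv.neg F).subtypeEquiv fun x => by simp
  rw [Nat.card_congr e, Nat.card_sigma, Nat.cast_sum, Nat.card_congr e']
  simp only [card_pappusParam_left, Finset.sum_add_distrib, Finset.sum_sub_distrib,
    ← Finset.mul_sum, Finset.sum_ite_eq', Finset.mem_univ, if_true, Finset.sum_const,
    Finset.card_univ, Finset.sum_boole, nsmul_eq_mul]
  rw [Nat.card_eq_fintype_card, Fintype.card_subtype]
  ring

/-- Three distinct points among `{0, …, 8}` form a line of the Pappus configuration. -/
def pappusLine (i j k : Fin 9) : Prop :=
  affinePappus (finProdFinEquiv.symm (i : Fin (3 * 3))) (finProdFinEquiv.symm (j : Fin (3 * 3)))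
    (finProdFinEquiv.symm (k : Fin (3 * 3)))

instance (i j k : Fin 9) : Decidable (pappusLine i j k) := by
  unfold pappusLine affinePappus; infer_instance

theorem mem_pappusLines_iff {i j k : Fin 9} (hij : i ≠ j) (hik : i ≠ k) (hjk : j ≠ k) :
    ({i, j, k} : Set (Fin 9)) ∈ pappusLines ↔ pappusLine i j k := by
  have key : ∀ i j k : Fin 9, i ≠ j → i ≠ k → j ≠ k →
      (({i, j, k} : Finset (Fin 9)) ∈ ({{0, 1, 2}, {3, 4, 5}, {6, 7, 8}, {0, 4, 8}, {1, 5, 6},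
        {2, 3, 7}, {0, 5, 7}, {1, 3, 8}, {2, 4, 6}} : Finset (Finset (Fin 9))) ↔
        pappusLine i j k) := by
    decide +kernel
  rw [← key i j k hij hik hjk]
  simp only [pappusLines, Set.mem_insert_iff, Set.mem_singleton_iff, Finset.mem_insert,
    Finset.mem_singleton, ← Finset.coe_inj, Finset.coe_insert, Finset.coe_singleton]

/-- The determinant of the matrix with the given rows. -/
def det3 {F : Type*} [Field F] (u v w : Fin 3 → F) : F :=
  (Matrix.of ![u, v, w]).det

theorem det3_eq {F : Type*} [Field F] (u v w : Fin 3 → F) :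
    det3 u v w = u 0 * (v 1 * w 2 - v 2 * w 1) - u 1 * (v 0 * w 2 - v 2 * w 0) +
      u 2 * (v 0 * w 1 - v 1 * w 0) := by
  simp [det3, Matrix.det_fin_three]
  ring

theorem det3_mulVec {F : Type*} [Field F] (M : Matrix (Fin 3) (Fin 3) F) (u v w : Fin 3 → F) :
    det3 (M.mulVec u) (M.mulVec v) (M.mulVec w) = M.det * det3 u v w := by
  have : Matrix.of ![M.mulVec u, M.mulVec v, M.mulVec w] =
      Matrix.of ![u, v, w] * M.transpose := by
    ext i j
    fin_cases i <;> simp [Matrix.mul_apply, Matrix.mulVec, dotProduct, mul_comm]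
  rw [det3, this, Matrix.det_mul, Matrix.det_transpose, mul_comm, det3]

theorem det3_smul {F : Type*} [Field F] (r s t : F) (u v w : Fin 3 → F) :
    det3 (r • u) (s • v) (t • w) = r * s * t * det3 u v w := by
  simp only [det3_eq, Pi.smul_apply, smul_eq_mul]
  ring

theorem p2Collinear_mk {F : Type} [Field F] {u v w : Fin 3 → F} (hu : u ≠ 0) (hv : v ≠ 0)
    (hw : w ≠ 0) :
    P2Collinear F (.mk F u hu) (.mk F v hv) (.mk F w hw) ↔ det3 u v w = 0 := by
  have h1 : (Projectivization.rep ∘ ![Projectivization.mk F u hu, .mk F v hv, .mk F w hw]) =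
      (Matrix.of ![(Projectivization.mk F u hu).rep, (Projectivization.mk F v hv).rep,
        (Projectivization.mk F w hw).rep]).row := by
    ext i; fin_cases i <;> rfl
  obtain ⟨r, hr⟩ := Projectivization.exists_smul_eq_mk_rep F u hu
  obtain ⟨s, hs⟩ := Projectivization.exists_smul_eq_mk_rep F v hv
  obtain ⟨t, ht⟩ := Projectivization.exists_smul_eq_mk_rep F w hw
  rw [P2Collinear, Projectivization.independent_iff, h1,
    Matrix.linearIndependent_rows_iff_isUnit, Matrix.isUnit_iff_isUnit_det, isUnit_iff_ne_zero,
    not_not, ← det3, ← hr, ← hs, ← ht]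
  simp only [Units.smul_def, det3_smul]
  simp

/-- A normal form for the vectors representing a Pappus configuration. -/
def pappusVec {F : Type*} [Field F] (a c : F) : Fin 9 → Fin 3 → F :=
  ![![1, 0, 0], ![0, 1, 0], ![1, a, 0], ![0, 0, 1], ![1, 1, 1], ![1, 1, c],
    ![1, a * (1 - c) + c, c], ![1, a, c * a], ![0, 1, 1]]

theorem pappusVec_ne_zero {F : Type*} [Field F] (a c : F) (i : Fin 9) : pappusVec a c i ≠ 0 := by
  fin_cases i <;> simp [pappusVec]

theorem det3_pappusVec_eq_zero_iff {F : Type*} [Field F] {a c : F} (h : PappusParam a c)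
    {i j k : Fin 9} (hij : i < j) (hjk : j < k) :
    det3 (pappusVec a c i) (pappusVec a c j) (pappusVec a c k) = 0 ↔ pappusLine i j k := by
  obtain ⟨h1, h2, h3, h4, h5, h6, h7⟩ := h
  fin_cases i <;> fin_cases j <;> first | (exfalso; revert hij; decide) | skip
  all_goals fin_cases k <;> first | (exfalso; revert hjk; decide) | skip
  all_goals
    first
    | refine iff_of_false ?_ (by decide)
      simp [det3_eq, pappusVec] <;> grind
    | refine iff_of_true ?_ (by decide)
      simp [det3_eq, pappusVec] <;> ring

theorem mem_strongRealizations_of_lt {ι P : Type*} [LinearOrder ι] {C : P → P → P → Prop}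
    {L : ι → ι → ι → Prop} {p : ι → P}
    (hC₁ : ∀ x y z, C x y z ↔ C y x z) (hC₂ : ∀ x y z, C x y z ↔ C x z y)
    (hL₁ : ∀ i j k, L i j k ↔ L j i k) (hL₂ : ∀ i j k, L i j k ↔ L i k j)
    (h : ∀ i j k, i < j → j < k → (C (p i) (p j) (p k) ↔ L i j k)) :
    p ∈ strongRealizations C L := by
  have h₁ : ∀ {i j k}, (C (p j) (p i) (p k) ↔ L j i k) → (C (p i) (p j) (p k) ↔ L i j k) :=
    fun h => by rwa [hC₁, hL₁]
  have h₂ : ∀ {i j k}, (C (p i) (p k) (p j) ↔ L i k j) → (C (p i) (p j) (p k) ↔ L i j k) :=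
    fun h => by rwa [hC₂, hL₂]
  intro i j k hij hik hjk
  rcases lt_or_gt_of_ne hij with h12 | h12 <;> rcases lt_or_gt_of_ne hjk with h23 | h23 <;>
    rcases lt_or_gt_of_ne hik with h13 | h13
  · exact h _ _ _ h12 h23
  · exact absurd (h12.trans h23) h13.asymm
  · exact h₂ (h _ _ _ h13 h23)
  · exact h₂ (h₁ (h _ _ _ h13 h12))
  · exact h₁ (h _ _ _ h12 h13)
  · exact h₁ (h₂ (h _ _ _ h23 h13))
  · exact absurd (h23.trans h12) h13.asymm
  · exact h₁ (h₂ (h₁ (h _ _ _ h23 h12)))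

/-- Three vectors of `F³` are linearly dependent. -/
def det3Zero {F : Type*} [Field F] (u v w : Fin 3 → F) : Prop :=
  det3 u v w = 0

theorem pappusVec_mem_strongRealizations {F : Type*} [Field F] {a c : F}
    (h : PappusParam a c) : pappusVec a c ∈ strongRealizations det3Zero pappusLine := by
  refine mem_strongRealizations_of_lt (fun u v w => ?_) (fun u v w => ?_) ?_ ?_
    fun i j k hij hjk => det3_pappusVec_eq_zero_iff h hij hjk
  · have : det3 u v w = -det3 v u w := by simp only [det3_eq]; ring
    rw [det3Zero, det3Zero, this, neg_eq_zero]
  · have : det3 u v w = -det3 u w v := by simp only [det3_eq]; ring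
    rw [det3Zero, det3Zero, this, neg_eq_zero]
  · decide +kernel
  · decide +kernel

theorem exists_eq_smul_pappusVec {F : Type*} [Field F] {w : Fin 9 → Fin 3 → F}
    (hw : w ∈ strongRealizations det3Zero pappusLine) (h0 : w 0 = ![1, 0, 0])
    (h1 : w 1 = ![0, 1, 0]) (h3 : w 3 = ![0, 0, 1]) (h4 : w 4 = ![1, 1, 1]) :
    ∃ a c, PappusParam a c ∧ ∀ i, ∃ s : F, s ≠ 0 ∧ w i = s • pappusVec a c i := by
  have on : ∀ i j k, i ≠ j → i ≠ k → j ≠ k → pappusLine i j k → det3 (w i) (w j) (w k) = 0 :=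
    fun i j k hij hik hjk h => (hw i j k hij hik hjk).2 h
  have off : ∀ i j k, i ≠ j → i ≠ k → j ≠ k → ¬ pappusLine i j k → det3 (w i) (w j) (w k) ≠ 0 :=
    fun i j k hij hik hjk h => (hw i j k hij hik hjk).not.2 h
  have vec : ∀ {u : Fin 3 → F} (s x y z : F), u 0 = s * x → u 1 = s * y → u 2 = s * z →
      u = s • ![x, y, z] := by
    intro u s x y z hx hy hz
    ext i
    fin_cases i <;> simpa
  have n2 := off 1 2 3 (by decide) (by decide) (by decide) (by decide)
  have z2 := on 0 1 2 (by decide) (by decide) (by decide) (by decide)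
  simp only [h0, h1, h3, det3_eq] at n2 z2
  simp at n2 z2
  have e2 : w 2 = w 2 0 • ![1, w 2 1 / w 2 0, 0] :=
    vec _ _ _ _ (by simp) (by field_simp) (by simpa using z2)
  have n5 := off 1 3 5 (by decide) (by decide) (by decide) (by decide)
  have z5 := on 3 4 5 (by decide) (by decide) (by decide) (by decide)
  simp only [h1, h3, h4, det3_eq] at n5 z5
  simp at n5 z5
  have e5 : w 5 = w 5 0 • ![1, 1, w 5 2 / w 5 0] :=
    vec _ _ _ _ (by simp) (by linear_combination z5) (by field_simp)
  set a := w 2 1 / w 2 0 with ha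
  set c := w 5 2 / w 5 0 with hc
  have n8 := off 0 1 8 (by decide) (by decide) (by decide) (by decide)
  have z8 := on 0 4 8 (by decide) (by decide) (by decide) (by decide)
  have z8' := on 1 3 8 (by decide) (by decide) (by decide) (by decide)
  simp only [h0, h1, h3, h4, det3_eq] at n8 z8 z8'
  simp at n8 z8 z8'
  have e8 : w 8 = w 8 2 • ![0, 1, 1] :=
    vec _ _ _ _ (by simpa using z8') (by linear_combination -z8) (by simp)
  have n6 := off 1 3 6 (by decide) (by decide) (by decide) (by decide)
  have z6 := on 1 5 6 (by decide) (by decide) (by decide) (by decide)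
  have z6' := on 2 4 6 (by decide) (by decide) (by decide) (by decide)
  rw [e5] at z6
  rw [e2] at z6'
  simp only [h1, h3, h4, det3_eq] at n6 z6 z6'
  simp at n6 z6 z6'
  have n7 := off 1 3 7 (by decide) (by decide) (by decide) (by decide)
  have z7 := on 0 5 7 (by decide) (by decide) (by decide) (by decide)
  have z7' := on 2 3 7 (by decide) (by decide) (by decide) (by decide)
  rw [e5] at z7
  rw [e2] at z7'
  simp only [h0, h1, h3, det3_eq] at n7 z7 z7'
  simp at n7 z7 z7'
  have e6 : w 6 = w 6 0 • ![1, a * (1 - c) + c, c] := by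
    have hz : w 6 2 = w 6 0 * c := mul_left_cancel₀ n5 (by linear_combination -z6)
    refine vec _ _ _ _ (by simp) (mul_left_cancel₀ n2 ?_) hz
    linear_combination -z6' + w 2 0 * (1 - a) * hz
  have e7 : w 7 = w 7 0 • ![1, a, c * a] := by
    have hy : w 7 1 = w 7 0 * a := mul_left_cancel₀ n2 (by linear_combination -z7')
    refine vec _ _ _ _ (by simp) hy (mul_left_cancel₀ n5 ?_)
    linear_combination z7 + w 5 0 * c * hy
  have hs : ∀ i, ∃ s : F, s ≠ 0 ∧ w i = s • pappusVec a c i := by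
    intro i
    fin_cases i
    · exact ⟨1, one_ne_zero, by simpa [pappusVec] using h0⟩
    · exact ⟨1, one_ne_zero, by simpa [pappusVec] using h1⟩
    · exact ⟨_, n2, e2⟩
    · exact ⟨1, one_ne_zero, by simpa [pappusVec] using h3⟩
    · exact ⟨1, one_ne_zero, by simpa [pappusVec] using h4⟩
    · exact ⟨_, n5, e5⟩
    · exact ⟨_, n6, e6⟩
    · exact ⟨_, n7, e7⟩
    · exact ⟨_, n8, e8⟩
  refine ⟨a, c, ?_, hs⟩
  have off' : ∀ i j k, i ≠ j → i ≠ k → j ≠ k → ¬ pappusLine i j k →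
      det3 (pappusVec a c i) (pappusVec a c j) (pappusVec a c k) ≠ 0 := by
    intro i j k hij hik hjk h h'
    obtain ⟨r, -, hr⟩ := hs i
    obtain ⟨s, -, hs'⟩ := hs j
    obtain ⟨t, -, ht⟩ := hs k
    refine off i j k hij hik hjk h ?_
    rw [hr, hs', ht, det3_smul, h', mul_zero]
  have d1 := off' 0 2 3 (by decide) (by decide) (by decide) (by decide)
  have d2 := off' 2 3 4 (by decide) (by decide) (by decide) (by decide)
  have d3 := off' 0 1 5 (by decide) (by decide) (by decide) (by decide)
  have d4 := off' 0 4 5 (by decide) (by decide) (by decide) (by decide)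
  have d5 := off' 1 4 7 (by decide) (by decide) (by decide) (by decide)
  have d6 := off' 2 5 8 (by decide) (by decide) (by decide) (by decide)
  have d7 := off' 0 3 6 (by decide) (by decide) (by decide) (by decide)
  clear_value a c
  clear off off' on e2 e5 e6 e7 e8
  simp [det3_eq, pappusVec] at d1 d2 d3 d4 d5 d6 d7
  refine ⟨?_, ?_, ?_, ?_, ?_, ?_, ?_⟩ <;> grind

theorem eq_one_of_mulVec_pappusVec {F : Type*} [Field F] {B : Matrix (Fin 3) (Fin 3) F}
    {a c a' c' : F} (hB : ∀ i, ∃ s : F, B.mulVec (pappusVec a c i) = s • pappusVec a' c' i)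
    (h4 : B.mulVec ![1, 1, 1] = ![1, 1, 1]) : B = 1 ∧ a = a' ∧ c = c' := by
  obtain ⟨s0, h0⟩ := hB 0
  obtain ⟨s1, h1⟩ := hB 1
  obtain ⟨s3, h3⟩ := hB 3
  simp only [pappusVec, funext_iff, Fin.forall_fin_succ, Matrix.mulVec, dotProduct,
    Fin.sum_univ_three] at h0 h1 h3 h4
  simp at h0 h1 h3 h4
  have h : B = 1 := by
    ext i j
    fin_cases i <;> fin_cases j <;> simp <;> grind
  subst h
  obtain ⟨s2, h2⟩ := hB 2
  obtain ⟨s5, h5⟩ := hB 5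
  simp only [pappusVec, funext_iff, Fin.forall_fin_succ, Matrix.one_mulVec] at h2 h5
  simp at h2 h5
  refine ⟨rfl, ?_, ?_⟩ <;> grind

theorem mulVec_pappusVec_ne_zero {F : Type*} [Field F] (g : GL (Fin 3) F) (a c : F)
    (i : Fin 9) : g.1.mulVec (pappusVec a c i) ≠ 0 := fun h =>
  pappusVec_ne_zero a c i
    (Matrix.mulVec_injective_of_isUnit g.isUnit (by rw [h, Matrix.mulVec_zero]))

/-- The image of the normal form `pappusVec a c` under a projective transformation. -/
def pappusPoint {F : Type*} [Field F] (g : GL (Fin 3) F) (a c : F) (i : Fin 9) :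
    Projectivization F (Fin 3 → F) :=
  .mk F (g.1.mulVec (pappusVec a c i)) (mulVec_pappusVec_ne_zero g a c i)

theorem pappusPoint_mem_strongRealizations {F : Type} [Field F] (g : GL (Fin 3) F) {a c : F}
    (h : PappusParam a c) :
    pappusPoint g a c ∈ strongRealizations (P2Collinear F) pappusLine := by
  intro i j k hij hik hjk
  rw [← pappusVec_mem_strongRealizations h i j k hij hik hjk, pappusPoint, pappusPoint,
    pappusPoint, p2Collinear_mk, det3_mulVec, det3Zero, mul_eq_zero, or_iff_right]
  exact ((Matrix.isUnit_iff_isUnit_det _).1 g.isUnit).ne_zero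

theorem eq_of_pappusPoint_eq {F : Type*} [Field F] {g g' : GL (Fin 3) F} {a c a' c' : F}
    (h : pappusPoint g a c = pappusPoint g' a' c')
    (h4 : g.1.mulVec ![1, 1, 1] = g'.1.mulVec ![1, 1, 1]) : g = g' ∧ a = a' ∧ c = c' := by
  have key : ∀ u v : Fin 3 → F, g.1.mulVec u = g'.1.mulVec v →
      (g'⁻¹ * g).1.mulVec u = v := by
    intro u v huv
    rw [Units.val_mul, ← Matrix.mulVec_mulVec, huv, Matrix.mulVec_mulVec, ← Units.val_mul,
      inv_mul_cancel, Units.val_one, Matrix.one_mulVec]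
  obtain ⟨h1, h2⟩ := eq_one_of_mulVec_pappusVec (B := (g'⁻¹ * g).1) (a := a) (c := c)
    (a' := a') (c' := c') (fun i => by
      obtain ⟨s, hs⟩ := (Projectivization.mk_eq_mk_iff' F _ _ _ _).1 (congrFun h i)
      exact ⟨s, key _ _ (by rw [← hs, Matrix.mulVec_smul])⟩) (key _ _ h4)
  refine ⟨?_, h2⟩
  have h3 : g'⁻¹ * g = 1 := Units.ext h1
  exact (inv_mul_eq_one.1 h3).symm

theorem exists_pappusPoint_eq {F : Type} [Field F] {p : Fin 9 → Projectivization F (Fin 3 → F)}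
    (hp : p ∈ strongRealizations (P2Collinear F) pappusLine) (u : Fˣ) :
    ∃ (g : GL (Fin 3) F) (a c : F), PappusParam a c ∧ pappusPoint g a c = p ∧
      u • g.1.mulVec ![1, 1, 1] = (p 4).rep := by
  let v : Fin 9 → Fin 3 → F := fun i => (p i).rep
  have hv : v ∈ strongRealizations det3Zero pappusLine := by
    intro i j k hij hik hjk
    rw [← hp i j k hij hik hjk, det3Zero, ← p2Collinear_mk (p i).rep_nonzero (p j).rep_nonzero
      (p k).rep_nonzero]
    simp only [Projectivization.mk_rep]
  have off : ∀ i j k, i ≠ j → i ≠ k → j ≠ k → ¬ pappusLine i j k → det3 (v i) (v j) (v k) ≠ 0 :=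
    fun i j k hij hik hjk h => (hv i j k hij hik hjk).not.2 h
  let M : Matrix (Fin 3) (Fin 3) F := (Matrix.of ![v 0, v 1, v 3]).transpose
  have hM : M.det ≠ 0 := by
    rw [Matrix.det_transpose]
    exact off 0 1 3 (by decide) (by decide) (by decide) (by decide)
  have hMu : IsUnit M.det := isUnit_iff_ne_zero.2 hM
  have M0 : v 0 = M.mulVec ![1, 0, 0] := by
    ext i; simp [M, Matrix.mulVec, dotProduct, Fin.sum_univ_three]
  have M1 : v 1 = M.mulVec ![0, 1, 0] := by
    ext i; simp [M, Matrix.mulVec, dotProduct, Fin.sum_univ_three]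
  have M3 : v 3 = M.mulVec ![0, 0, 1] := by
    ext i; simp [M, Matrix.mulVec, dotProduct, Fin.sum_univ_three]
  let x : Fin 3 → F := (M⁻¹).mulVec (u⁻¹ • v 4)
  have Mx : M.mulVec x = u⁻¹ • v 4 := by
    simp only [x, Matrix.mulVec_mulVec, Matrix.mul_nonsing_inv _ hMu, Matrix.one_mulVec]
  have M4 : v 4 = M.mulVec (u • x) := by
    rw [Matrix.mulVec_smul, Mx, smul_inv_smul]
  have hx0 : x 0 ≠ 0 := by
    have := off 4 1 3 (by decide) (by decide) (by decide) (by decide)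
    rw [M1, M3, M4, det3_mulVec, det3_eq] at this
    simpa [hM, Units.smul_def] using this
  have hx1 : x 1 ≠ 0 := by
    have := off 4 0 3 (by decide) (by decide) (by decide) (by decide)
    rw [M0, M3, M4, det3_mulVec, det3_eq] at this
    simpa [hM, Units.smul_def] using this
  have hx2 : x 2 ≠ 0 := by
    have := off 4 0 1 (by decide) (by decide) (by decide) (by decide)
    rw [M0, M1, M4, det3_mulVec, det3_eq] at this
    simpa [hM, Units.smul_def] using this
  have hg : IsUnit (M * Matrix.diagonal x).det := by
    simp [Matrix.det_mul, Matrix.det_diagonal, Fin.prod_univ_three, hM, hx0, hx1, hx2]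
  let g : GL (Fin 3) F := Matrix.GeneralLinearGroup.mk'' (M * Matrix.diagonal x) hg
  have gval : ∀ y, g.1.mulVec y = M.mulVec (fun i => x i * y i) := by
    intro y
    change (M * Matrix.diagonal x).mulVec y = _
    rw [← Matrix.mulVec_mulVec]
    congr 1
    ext i
    exact Matrix.mulVec_diagonal _ _ _
  have ginv : ∀ y z, g.1.mulVec y = z → (g⁻¹).1.mulVec z = y := by
    rintro y _ rfl
    rw [Matrix.mulVec_mulVec, ← Units.val_mul, inv_mul_cancel, Units.val_one, Matrix.one_mulVec]
  let r : Fin 9 → F := ![x 0, x 1, 1, x 2, (u⁻¹ : Fˣ), 1, 1, 1, 1]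
  have hr : ∀ i, r i ≠ 0 := by
    intro i
    fin_cases i <;> simp [r, hx0, hx1, hx2]
  let w : Fin 9 → Fin 3 → F := fun i => (g⁻¹).1.mulVec (r i • v i)
  have hw : w ∈ strongRealizations det3Zero pappusLine := by
    intro i j k hij hik hjk
    rw [← hv i j k hij hik hjk, det3Zero, det3Zero]
    have : (g⁻¹).1.det ≠ 0 := ((Matrix.isUnit_iff_isUnit_det _).1 (g⁻¹).isUnit).ne_zero
    simp only [w, det3_mulVec, det3_smul, mul_eq_zero, this, hr, false_or]
  obtain ⟨a, c, hac, hs⟩ := exists_eq_smul_pappusVec hw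
    (ginv _ _ (by
      rw [gval, M0, ← Matrix.mulVec_smul]; congr 1; ext i; fin_cases i <;> simp [r]))
    (ginv _ _ (by
      rw [gval, M1, ← Matrix.mulVec_smul]; congr 1; ext i; fin_cases i <;> simp [r]))
    (ginv _ _ (by
      rw [gval, M3, ← Matrix.mulVec_smul]; congr 1; ext i; fin_cases i <;> simp [r]))
    (ginv _ _ (by
      rw [gval, show r 4 • v 4 = u⁻¹ • v 4 from rfl, ← Mx]
      congr 1; ext i; fin_cases i <;> simp))
  refine ⟨g, a, c, hac, ?_, ?_⟩
  · ext1 i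
    obtain ⟨s, hs0, hs⟩ := hs i
    rw [pappusPoint, ← (p i).mk_rep, Projectivization.mk_eq_mk_iff']
    refine ⟨s⁻¹ * r i, ?_⟩
    have h1 : g.1.mulVec (w i) = r i • v i := by
      simp only [w, Matrix.mulVec_mulVec, ← Units.val_mul, mul_inv_cancel, Units.val_one,
        Matrix.one_mulVec]
    rw [hs, Matrix.mulVec_smul] at h1
    rw [mul_smul, ← show v i = (p i).rep from rfl, ← h1, inv_smul_smul₀ hs0]
  · rw [gval, show (fun i => x i * (![1, 1, 1] : Fin 3 → F) i) = x by
      ext i; fin_cases i <;> simp, Mx, smul_inv_smul]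

theorem card_strongRealizations_pappusLine_mul (F : Type) [Field F] :
    Nat.card (strongRealizations (P2Collinear F) pappusLine) * Nat.card Fˣ =
      Nat.card (GL (Fin 3) F) * Nat.card {x : F × F // PappusParam x.1 x.2} := by
  rw [← Nat.card_prod, ← Nat.card_prod]
  choose u hu using fun y : GL (Fin 3) F × {x : F × F // PappusParam x.1 x.2} =>
    Projectivization.exists_smul_eq_mk_rep F _ (mulVec_pappusVec_ne_zero y.1 y.2.1.1 y.2.1.2 4)
  symm
  refine Nat.card_eq_of_bijective (fun y => (⟨pappusPoint y.1 y.2.1.1 y.2.1.2,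
    pappusPoint_mem_strongRealizations y.1 y.2.2⟩, u y)) ⟨?_, ?_⟩
  · rintro ⟨g, ⟨a, c⟩, h⟩ ⟨g', ⟨a', c'⟩, h'⟩ heq
    obtain ⟨h1, h2⟩ := Prod.mk.inj heq
    have h1 : pappusPoint g a c = pappusPoint g' a' c' := congrArg Subtype.val h1
    have h3 := (hu (g, ⟨(a, c), h⟩)).trans ((congrArg Projectivization.rep (congrFun h1 4)).trans
      (hu (g', ⟨(a', c'), h'⟩)).symm)
    rw [h2] at h3
    obtain ⟨rfl, rfl, rfl⟩ := eq_of_pappusPoint_eq h1 (smul_left_cancel _ h3)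
    rfl
  · rintro ⟨⟨p, hp⟩, s⟩
    obtain ⟨g, a, c, hac, rfl, h4⟩ := exists_pappusPoint_eq hp s
    refine ⟨(g, ⟨(a, c), hac⟩), Prod.ext rfl ?_⟩
    have h5 := (hu (g, ⟨(a, c), hac⟩)).trans h4.symm
    exact Units.ext (smul_left_injective F (mulVec_pappusVec_ne_zero g a c 4) h5)

theorem injective_of_mem_strongRealizations {F : Type} [Field F]
    {p : Fin 9 → Projectivization F (Fin 3 → F)}
    (hp : p ∈ strongRealizations (P2Collinear F) pappusLine) : Function.Injective p := by
  intro i j hpij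
  by_contra hij
  have key : ∀ i j : Fin 9, i ≠ j → ∃ k, i ≠ k ∧ j ≠ k ∧ ¬ pappusLine i j k := by
    decide +kernel
  obtain ⟨k, hik, hjk, hk⟩ := key i j hij
  refine hk ((hp i j k hij hik hjk).1 ?_)
  rw [hpij, ← (p j).mk_rep, ← (p k).mk_rep, p2Collinear_mk, det3_eq]
  ring

theorem card_tripleAut_pappusLine : Nat.card (tripleAut pappusLine) = 108 :=
  (card_tripleAut_congr (κ := ZMod 3 × ZMod 3) (L := pappusLine) (L' := affinePappus)
    (finProdFinEquiv (m := 3) (n := 3)).symm fun _ _ _ _ _ _ => Iff.rfl).trans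
    card_tripleAut_affinePappus

theorem p2Pappus_mul (F : Type) [Field F] :
    P2Pappus F * 108 = Nat.card (strongRealizations (P2Collinear F) pappusLine) * 362880 := by
  have h := card_relabelings_mul_card_tripleAut (P2Collinear F) pappusLine
  rw [card_tripleAut_pappusLine, Nat.card_perm, Nat.card_fin,
    show Nat.factorial 9 = 362880 from rfl] at h
  rw [← h, P2Pappus]
  congr 1
  refine Nat.card_congr (Equiv.subtypeEquivRight fun p => ⟨?_, ?_⟩)
  · rintro ⟨-, σ, hσ⟩
    exact ⟨σ, fun i j k hij hik hjk =>
      (hσ i j k hij hik hjk).trans (mem_pappusLines_iff hij hik hjk)⟩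
  · rintro ⟨σ, hσ⟩
    refine ⟨?_, σ, fun i j k hij hik hjk =>
      (hσ i j k hij hik hjk).trans (mem_pappusLines_iff hij hik hjk).symm⟩
    exact (σ.injective_comp p).1 (injective_of_mem_strongRealizations hσ)

/-- The number of ordered strong realizations of the Pappus configuration in
`ℙ²(F_q)` is `3360·((q−2−b(q))(q−5) + (q−3)b(q))·(q²+q+1)(q²+q)q²(q−1)²`,
where `b(q) = #{x ∈ F_q : x² + x + 1 = 0}`. -/
theorem count_pappus_realizations (F : Type) [Field F] [Fintype F]
    (q b : ℤ) (hq : q = Fintype.card F)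
    (hb : b = Nat.card {x : F // x ^ 2 + x + 1 = 0}) :
    (P2Pappus F : ℤ) =
      3360 * ((q - 2 - b) * (q - 5) + (q - 3) * b) *
        ((q ^ 2 + q + 1) * (q ^ 2 + q) * q ^ 2 * (q - 1) ^ 2) := by
  have h1 := p2Pappus_mul F
  have h2 := card_strongRealizations_pappusLine_mul F
  have h3 := card_pappusParam F
  have hpos : 1 < Fintype.card F := Fintype.one_lt_card
  have hle : ∀ i ≤ 3, Fintype.card F ^ i ≤ Fintype.card F ^ 3 := fun i hi =>
    Nat.pow_le_pow_right hpos.le hi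
  rw [Matrix.card_GL_field, Fin.prod_univ_three, Nat.card_units, Nat.card_eq_fintype_card (α := F)]
    at h2
  have h1 := congrArg (Nat.cast (R := ℤ)) h1
  have h2 := congrArg (Nat.cast (R := ℤ)) h2
  simp only [Nat.cast_mul, Fin.val_zero, Fin.val_one, Fin.val_two, Nat.cast_sub hpos.le,
    Nat.cast_sub (hle 0 (by norm_num)), Nat.cast_sub (hle 1 (by norm_num)),
    Nat.cast_sub (hle 2 (by norm_num)), Nat.cast_pow, Nat.cast_one, h3, ← hq, ← hb] at h1 h2
  have hq1 : q - 1 ≠ 0 := by rw [hq]; omega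
  refine mul_left_cancel₀ hq1 ?_
  push_cast at h1
  have h4 : (P2Pappus F : ℤ) =
      3360 * (Nat.card (strongRealizations (P2Collinear F) pappusLine) : ℤ) := by omega
  linear_combination (q - 1) * h4 + 3360 * h2
end

section
/- Let q be a prime power. The number of ordered 7-arcs in ℙ²(F_q) is C_7(q) = (q^2+q+1)(q^2+q)q^2(q-1)^2 · [ (q-3)(q-5)(q^4 - 20q^3 + 148q^2 - 468q + 498) - 30·a(q) ], where a(q) = 1 if q is even and a(q) = 0 if q is odd; in particular, C_7(q) is a quasipolynomial in q of period 2. -/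
namespace PlaneArcs

open Configuration Finset

section Incidence

variable {P : Type*} (L : Type*) [Membership P L] [ProjectivePlane P L]

theorem exists_mem_mem (x y : P) : ∃ l : L, x ∈ l ∧ y ∈ l := by
  by_cases h : x = y
  · obtain ⟨z, hz⟩ : ∃ z : P, x ≠ z := by
      by_contra! hall
      obtain ⟨p₁, p₂, -, -, l, -, h₁, -, -, h₂, -⟩ :=
        ProjectivePlane.exists_config (P := P) (L := L)
      exact h₁ (hall p₁ ▸ hall p₂ ▸ h₂)
    exact ⟨HasLines.mkLine hz, (HasLines.mkLine_ax hz).1, h ▸ (HasLines.mkLine_ax hz).1⟩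
  · exact ⟨HasLines.mkLine h, HasLines.mkLine_ax h⟩

/-- The line through two points; an arbitrary line through the point if they coincide. -/
noncomputable def join (x y : P) : L := (exists_mem_mem L x y).choose

theorem left_mem_join (x y : P) : x ∈ join L x y := (exists_mem_mem L x y).choose_spec.1

theorem right_mem_join (x y : P) : y ∈ join L x y := (exists_mem_mem L x y).choose_spec.2

variable {L}

theorem exists_common_point (l m : L) : ∃ x : P, x ∈ l ∧ x ∈ m :=
  exists_mem_mem (P := Dual L) (Dual P) l m

variable (P) in
/-- The common point of two lines; an arbitrary point of the line if they coincide. -/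
noncomputable def meet (l m : L) : P := (exists_common_point l m).choose

theorem meet_mem_left (l m : L) : meet P l m ∈ l :=
  (exists_common_point (P := P) l m).choose_spec.1

theorem meet_mem_right (l m : L) : meet P l m ∈ m :=
  (exists_common_point (P := P) l m).choose_spec.2

theorem eq_join {x y : P} {l : L} (h : x ≠ y) (hx : x ∈ l) (hy : y ∈ l) : l = join L x y :=
  (Nondegenerate.eq_or_eq hx hy (left_mem_join L x y) (right_mem_join L x y)).resolve_left h

theorem eq_meet {x : P} {l m : L} (h : l ≠ m) (hl : x ∈ l) (hm : x ∈ m) : x = meet P l m :=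
  (Nondegenerate.eq_or_eq hl (meet_mem_left l m) hm (meet_mem_right l m)).resolve_right h

variable (L) in
/-- No line contains all three points. -/
def NonCollinear (x y z : P) : Prop := ∀ l : L, x ∈ l → y ∈ l → z ∉ l

/-- The finite set of points of a line. -/
noncomputable def points [Fintype P] (l : L) : Finset P := by
  classical exact univ.filter (· ∈ l)

omit [ProjectivePlane P L] in
@[simp]
theorem mem_points [Fintype P] {l : L} {x : P} : x ∈ points l ↔ x ∈ l := by
  simp [points]

theorem card_points_line [Fintype P] [Finite L] (l : L) :
    #(points (P := P) l) = ProjectivePlane.order P L + 1 := by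
  classical
  rw [← ProjectivePlane.pointCount_eq P l, pointCount, Nat.card_eq_fintype_card,
    Fintype.card_subtype, points]

open scoped Classical in
/-- The points of the line through two diagonal points of a quadrangle that lie on none of its
six sides. -/
theorem card_line_avoiding_quadrangle [Fintype P] [Finite L] {a b c d D E F : P}
    (h₁ : NonCollinear L a b c) (h₂ : NonCollinear L a b d) (h₃ : NonCollinear L a c d)
    (h₄ : NonCollinear L b c d)
    (hD : D ∈ join L a b) (hD' : D ∈ join L c d)
    (hE : E ∈ join L a c) (hE' : E ∈ join L b d)
    (hF : F ∈ join L a d) (hF' : F ∈ join L b c) :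
    (#{R ∈ points (join L D E) | R ∉ join L a b ∧ R ∉ join L c d ∧ R ∉ join L a c ∧
      R ∉ join L b d ∧ R ∉ join L a d ∧ R ∉ join L b c} : ℤ) =
      ProjectivePlane.order P L - 3 + if F ∈ join L D E then 1 else 0 := by
  have key := @Nondegenerate.eq_or_eq P L _ _
  have jl := @left_mem_join P L _ _
  have jr := @right_mem_join P L _ _
  simp only [NonCollinear] at h₁ h₂ h₃ h₄
  set l := join L D E
  have hDl : D ∈ l := jl _ _
  have hEl : E ∈ l := jr _ _
  have Xl := meet_mem_left (P := P) l (join L a d)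
  have Xr := meet_mem_right (P := P) l (join L a d)
  have Yl := meet_mem_left (P := P) l (join L b c)
  have Yr := meet_mem_right (P := P) l (join L b c)
  set X := meet P l (join L a d)
  set Y := meet P l (join L b c)
  have jab := And.intro (jl a b) (jr a b)
  have jcd := And.intro (jl c d) (jr c d)
  have jac := And.intro (jl a c) (jr a c)
  have jbd := And.intro (jl b d) (jr b d)
  have jad := And.intro (jl a d) (jr a d)
  have jbc := And.intro (jl b c) (jr b c)
  generalize join L a b = lab at *
  generalize join L c d = lcd at *
  generalize join L a c = lac at *
  generalize join L b d = lbd at *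
  generalize join L a d = lad at *
  generalize join L b c = lbc at *
  clear_value l X Y
  clear jl jr
  have e1 : D ≠ E := by grind
  have e2 : X ≠ D := by grind
  have e3 : X ≠ E := by grind
  have e4 : Y ≠ D := by grind
  have e5 : Y ≠ E := by grind
  have hXY : X = Y ↔ F ∈ l := by grind
  have hset : {R ∈ points l | R ∉ lab ∧ R ∉ lcd ∧ R ∉ lac ∧ R ∉ lbd ∧ R ∉ lad ∧ R ∉ lbc} =
      points (P := P) l \ {D, E, X, Y} := by
    ext R
    simp only [mem_filter, mem_sdiff, mem_points, mem_insert, mem_singleton]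
    have n1 : l ≠ lab := by grind
    have n2 : l ≠ lcd := by grind
    have n3 : l ≠ lac := by grind
    have n4 : l ≠ lbd := by grind
    have n5 : l ≠ lad := by grind
    have n6 : l ≠ lbc := by grind
    grind
  have hsub : ({D, E, X, Y} : Finset P) ⊆ points l := by
    intro R
    simp only [mem_points, mem_insert, mem_singleton]
    clear * - hDl hEl Xl Yl
    grind
  rw [hset, cast_card_sdiff hsub, card_points_line]
  clear key h₁ h₂ h₃ h₄
  by_cases hFl : F ∈ l
  · have : #({D, E, X, Y} : Finset P) = 3 := by grind
    rw [this, if_pos hFl]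
    push_cast
    ring
  · have : #({D, E, X, Y} : Finset P) = 4 := by grind
    rw [this, if_neg hFl]
    push_cast
    ring

set_option maxHeartbeats 1000000 in
open scoped Classical in
/-- The points of the line joining a vertex `o` of a pentagon to a diagonal point `D` of the
remaining quadrangle that lie on none of the ten joins of the vertices. -/
theorem card_line_avoiding_pentagon [Fintype P] [Finite L] {o a b c d D E F : P}
    (h₁ : NonCollinear L a b c) (h₂ : NonCollinear L a b d) (h₃ : NonCollinear L a c d)
    (h₄ : NonCollinear L b c d) (h₅ : NonCollinear L o a b) (h₆ : NonCollinear L o a c)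
    (h₇ : NonCollinear L o a d) (h₈ : NonCollinear L o b c) (h₉ : NonCollinear L o b d)
    (h₁₀ : NonCollinear L o c d)
    (hD : D ∈ join L a b) (hD' : D ∈ join L c d)
    (hE : E ∈ join L a c) (hE' : E ∈ join L b d)
    (hF : F ∈ join L a d) (hF' : F ∈ join L b c) :
    (#{R ∈ points (join L D o) | (R ∉ join L a b ∧ R ∉ join L c d ∧ R ∉ join L a c ∧
      R ∉ join L b d ∧ R ∉ join L a d ∧ R ∉ join L b c) ∧
      R ∉ join L o a ∧ R ∉ join L o b ∧ R ∉ join L o c ∧ R ∉ join L o d} : ℤ) =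
      ProjectivePlane.order P L - 5 + (if o ∈ join L D E then 1 else 0) +
        if o ∈ join L D F then 1 else 0 := by
  have key := @Nondegenerate.eq_or_eq P L _ _
  have jl := @left_mem_join P L _ _
  have jr := @right_mem_join P L _ _
  simp only [NonCollinear] at h₁ h₂ h₃ h₄ h₅ h₆ h₇ h₈ h₉ h₁₀
  have jDE := And.intro (jl D E) (jr D E)
  have jDF := And.intro (jl D F) (jr D F)
  set l := join L D o
  have hDl : D ∈ l := jl _ _
  have hol : o ∈ l := jr _ _
  have jab := And.intro (jl a b) (jr a b)
  have jcd := And.intro (jl c d) (jr c d)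
  have jac := And.intro (jl a c) (jr a c)
  have jbd := And.intro (jl b d) (jr b d)
  have jad := And.intro (jl a d) (jr a d)
  have jbc := And.intro (jl b c) (jr b c)
  have joa := And.intro (jl o a) (jr o a)
  have job := And.intro (jl o b) (jr o b)
  have joc := And.intro (jl o c) (jr o c)
  have jod := And.intro (jl o d) (jr o d)
  obtain ⟨X, Xl, Xr⟩ := exists_common_point (P := P) l (join L a c)
  obtain ⟨X', X'l, X'r⟩ := exists_common_point (P := P) l (join L b d)
  obtain ⟨Y, Yl, Yr⟩ := exists_common_point (P := P) l (join L a d)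
  obtain ⟨Y', Y'l, Y'r⟩ := exists_common_point (P := P) l (join L b c)
  generalize join L a b = lab at *
  generalize join L c d = lcd at *
  generalize join L a c = lac at *
  generalize join L b d = lbd at *
  generalize join L a d = lad at *
  generalize join L b c = lbc at *
  generalize join L o a = loa at *
  generalize join L o b = lob at *
  generalize join L o c = loc at *
  generalize join L o d = lod at *
  generalize join L D E = lDE at *
  generalize join L D F = lDF at *
  clear_value l
  clear jl jr
  have oD : D ≠ o := by grind
  have DE : D ≠ E := by grind
  have DF : D ≠ F := by grind
  have oE : o ∈ lDE ↔ E ∈ l := by grind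
  have oF : o ∈ lDF ↔ F ∈ l := by grind
  have la : a ∉ l := by grind
  have lb : b ∉ l := by grind
  have lc : c ∉ l := by grind
  have ld : d ∉ l := by grind
  have e1 : X ≠ D ∧ X ≠ o := by grind
  have e2 : X' ≠ D ∧ X' ≠ o := by grind
  have e3 : Y ≠ D ∧ Y ≠ o := by grind
  have e4 : Y' ≠ D ∧ Y' ≠ o := by grind
  have e5 : X ≠ Y ∧ X ≠ Y' := by grind
  have e6 : X' ≠ Y ∧ X' ≠ Y' := by grind
  have hX : X = X' ↔ E ∈ l := by grind
  have hY : Y = Y' ↔ F ∈ l := by grind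
  have hset : {R ∈ points l | (R ∉ lab ∧ R ∉ lcd ∧ R ∉ lac ∧ R ∉ lbd ∧ R ∉ lad ∧ R ∉ lbc) ∧
      R ∉ loa ∧ R ∉ lob ∧ R ∉ loc ∧ R ∉ lod} =
      points (P := P) l \ {o, D, X, X', Y, Y'} := by
    ext R
    simp only [mem_filter, mem_sdiff, mem_points, mem_insert, mem_singleton]
    clear e1 e2 e3 e4 e5 e6 hX hY oE oF
    refine and_congr_right fun hR => ?_
    have k : ∀ {m : L} {Z : P}, Z ∈ l → Z ∈ m → l ≠ m → (R ∈ m ↔ R = Z) := by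
      clear * - key hR
      grind
    rw [k hDl hD (by grind), k hDl hD' (by grind), k Xl Xr (by grind), k X'l X'r (by grind),
      k Yl Yr (by grind), k Y'l Y'r (by grind), k hol joa.1 (by grind), k hol job.1 (by grind),
      k hol joc.1 (by grind), k hol jod.1 (by grind)]
    tauto
  have hsub : ({o, D, X, X', Y, Y'} : Finset P) ⊆ points l := by
    intro R
    simp only [mem_points, mem_insert, mem_singleton]
    clear * - hol hDl Xl X'l Yl Y'l
    grind
  rw [hset, cast_card_sdiff hsub, card_points_line]
  simp only [oE, oF, ← hX, ← hY]
  clear key h₁ h₂ h₃ h₄ h₅ h₆ h₇ h₈ h₉ h₁₀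
  have : (#({o, D, X, X', Y, Y'} : Finset P) : ℤ) =
      6 - (if X = X' then 1 else 0) - if Y = Y' then 1 else 0 := by
    split_ifs <;> grind
  rw [this]
  push_cast
  ring

end Incidence

section Edges

/-- The pairs `i < j` in `Fin n`. -/
def edges (n : ℕ) : Finset (Fin n × Fin n) := {e | e.1 < e.2}

/-- Two pairs without a common entry. -/
def EdgeDisjoint {n : ℕ} (e f : Fin n × Fin n) : Prop :=
  e.1 ≠ f.1 ∧ e.1 ≠ f.2 ∧ e.2 ≠ f.1 ∧ e.2 ≠ f.2

instance {n : ℕ} : DecidableRel (EdgeDisjoint (n := n)) := fun _ _ => by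
  unfold EdgeDisjoint; infer_instance

/-- The sets of `k` mutually disjoint pairs in `Fin n`. -/
def matchings (n k : ℕ) : Finset (Finset (Fin n × Fin n)) :=
  {T ∈ powersetCard k (edges n) | ∀ e ∈ T, ∀ f ∈ T, e ≠ f → EdgeDisjoint e f}

theorem card_edges {n : ℕ} (hn : n ≤ 6) : #(edges n) = n.choose 2 := by
  interval_cases n <;> decide +kernel

theorem card_matchings_two {n : ℕ} (hn : n ≤ 6) : #(matchings n 2) = 3 * n.choose 4 := by
  interval_cases n <;> decide +kernel

theorem matchings_three_eq_empty {n : ℕ} (hn : n ≤ 5) : matchings n 3 = ∅ := by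
  interval_cases n <;> decide +kernel

theorem card_matchings_six_three : #(matchings 6 3) = 15 := by
  decide +kernel

theorem card_le_of_edgeDisjoint {n : ℕ} {T : Finset (Fin n × Fin n)} (hT : T ⊆ edges n)
    (h : ∀ e ∈ T, ∀ f ∈ T, e ≠ f → EdgeDisjoint e f) : 2 * #T ≤ n := by
  have hcard : #(T.biUnion fun e => {e.1, e.2}) = #T * 2 := by
    rw [card_biUnion fun e he f hf hef => ?_]
    · rw [sum_const_nat fun e he => card_pair (mem_filter.1 (hT he)).2.ne]
    · have := h e he f hf hef
      simp only [EdgeDisjoint] at this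
      simp [this.1.symm, this.2.1.symm, this.2.2.1.symm, this.2.2.2.symm]
  have := card_le_univ (T.biUnion fun e => ({e.1, e.2} : Finset (Fin n)))
  rw [hcard, Fintype.card_fin] at this
  omega

end Edges

section Arcs

variable {P : Type*} (L : Type*) [Membership P L]

/-- The entries of `p` are distinct and no three of them are collinear. -/
def IsArc {n : ℕ} (p : Fin n → P) : Prop :=
  Function.Injective p ∧
    ∀ i j k : Fin n, i ≠ j → i ≠ k → j ≠ k → NonCollinear L (p i) (p j) (p k)

variable (P) in
/-- The finite set of ordered `n`-arcs. -/
noncomputable def arcs [Fintype P] (n : ℕ) : Finset (Fin n → P) := by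
  classical exact univ.filter (IsArc L)

/-- The points that extend a tuple to an arc. -/
noncomputable def extensions [Fintype P] {n : ℕ} (p : Fin n → P) : Finset P := by
  classical exact univ.filter fun R => IsArc L (Fin.cons R p : Fin (n + 1) → P)

variable {L}

@[simp]
theorem mem_arcs [Fintype P] {n : ℕ} {p : Fin n → P} : p ∈ arcs P L n ↔ IsArc L p := by
  simp [arcs]

theorem IsArc.comp {n m : ℕ} {p : Fin n → P} (hp : IsArc L p) {σ : Fin m → Fin n}
    (hσ : Function.Injective σ) : IsArc L (p ∘ σ) :=
  ⟨hp.1.comp hσ, fun _ _ _ hij hik hjk =>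
    hp.2 _ _ _ (hσ.ne hij) (hσ.ne hik) (hσ.ne hjk)⟩

theorem IsArc.tail {n : ℕ} {p : Fin (n + 1) → P} (hp : IsArc L p) : IsArc L (Fin.tail p) :=
  hp.comp (Fin.succ_injective n)

theorem sum_arcs_succ [Fintype P] {n : ℕ} (f : (Fin (n + 1) → P) → ℤ) :
    ∑ p ∈ arcs P L (n + 1), f p =
      ∑ p ∈ arcs P L n, ∑ R ∈ extensions L p, f (Fin.cons R p : Fin (n + 1) → P) := by
  rw [sum_sigma']
  refine sum_nbij' (fun p => ⟨Fin.tail p, p 0⟩) (fun x => Fin.cons x.2 x.1) ?_ ?_ ?_ ?_ ?_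
  · intro p hp
    simp_all [extensions, IsArc.tail]
  · rintro ⟨p, R⟩ h
    simp_all [extensions]
  · simp
  · simp
  · simp

variable [ProjectivePlane P L]

theorem IsArc.eq_or_eq_of_mem_join {n : ℕ} {p : Fin n → P} (hp : IsArc L p) {i j k : Fin n}
    (hij : i ≠ j) (h : p k ∈ join L (p i) (p j)) : k = i ∨ k = j := by
  by_contra! hk
  exact hp.2 i j k hij hk.1.symm hk.2.symm _ (left_mem_join L _ _) (right_mem_join L _ _) h

theorem mem_extensions [Fintype P] {n : ℕ} {p : Fin n → P} (hp : IsArc L p) {R : P} :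
    R ∈ extensions L p ↔
      (∀ i, R ≠ p i) ∧ ∀ i j, i ≠ j → R ∉ join L (p i) (p j) := by
  simp only [extensions, mem_filter, mem_univ, true_and]
  constructor
  · intro h
    refine ⟨fun i hR => ?_, fun i j hij hR => ?_⟩
    · have := @h.1 0 i.succ (by simpa using hR)
      exact (Fin.succ_ne_zero i).symm this
    · refine h.2 i.succ j.succ 0 (by simpa using hij) (Fin.succ_ne_zero _) (Fin.succ_ne_zero _)
        (join L (p i) (p j)) ?_ ?_ ?_
      · simpa using left_mem_join L _ _
      · simpa using right_mem_join L _ _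
      · simpa using hR
  · rintro ⟨h₁, h₂⟩
    have key : ∀ {i j} {l : L}, i ≠ j → R ∈ l → p i ∈ l → p j ∉ l := fun {i j l} hij hR hi hj =>
      h₂ i j hij (eq_join (hp.1.ne hij) hi hj ▸ hR)
    refine ⟨Fin.cons_injective_iff.2 ⟨by simpa [eq_comm] using h₁, hp.1⟩, ?_⟩
    intro i j k hij hik hjk l hi hj hk
    induction i using Fin.cases <;> induction j using Fin.cases <;>
      induction k using Fin.cases <;> simp_all
    · exact key hjk hi hj hk
    · exact key hik hj hi hk
    · exact key hij hk hi hj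
    · exact hp.2 _ _ _ hij hik hjk _ hi hj hk

theorem join_comm {x y : P} (h : x ≠ y) : join L x y = join L y x :=
  eq_join h.symm (right_mem_join L _ _) (left_mem_join L _ _)

theorem mem_extensions_iff_lt [Fintype P] {n : ℕ} (hn : 2 ≤ n) {p : Fin n → P} (hp : IsArc L p)
    {R : P} : R ∈ extensions L p ↔ ∀ i j, i < j → R ∉ join L (p i) (p j) := by
  rw [mem_extensions hp]
  refine ⟨fun h i j hij => h.2 i j hij.ne, fun h => ?_⟩
  have hne : ∀ i j, i ≠ j → R ∉ join L (p i) (p j) := by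
    intro i j hij
    rcases hij.lt_or_gt with hlt | hlt
    · exact h i j hlt
    · rw [join_comm (hp.1.ne hij)]
      exact h j i hlt
  refine ⟨fun i hi => ?_, hne⟩
  have : Nontrivial (Fin n) := Fin.nontrivial_iff_two_le.2 hn
  obtain ⟨j, hj⟩ := exists_ne i
  exact hne i j hj.symm (hi ▸ left_mem_join L _ _)

variable (L) in
/-- The lines joining the pairs in `T` have a common point. -/
def Concurrent {n : ℕ} (p : Fin n → P) (T : Finset (Fin n × Fin n)) : Prop :=
  ∃ R, ∀ e ∈ T, R ∈ join L (p e.1) (p e.2)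

open scoped Classical in
variable (L) in
/-- The pairs whose joining line passes through `R`. -/
noncomputable def edgesThrough {n : ℕ} (p : Fin n → P) (R : P) : Finset (Fin n × Fin n) :=
  {e ∈ edges n | R ∈ join L (p e.1) (p e.2)}

theorem IsArc.edgeDisjoint {n : ℕ} {p : Fin n → P} (hp : IsArc L p) {R : P}
    (hR : ∀ i, R ≠ p i) {e f : Fin n × Fin n} (he : e ∈ edgesThrough L p R)
    (hf : f ∈ edgesThrough L p R) (hef : e ≠ f) : EdgeDisjoint e f := by
  simp only [edgesThrough, edges, mem_filter, mem_univ, true_and] at he hf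
  have key : ∀ {i j k l : Fin n}, R ∈ join L (p i) (p j) → R ∈ join L (p k) (p l) →
      i ≠ j → k ≠ l → (i = k ∨ i = l) → j = k ∨ j = l := by
    intro i j k l h₁ h₂ hij hkl hi
    have hi' : p i ∈ join L (p k) (p l) := by
      rcases hi with rfl | rfl
      · exact left_mem_join _ _ _
      · exact right_mem_join _ _ _
    have := (Nondegenerate.eq_or_eq h₁ (left_mem_join L _ _) h₂ hi').resolve_left (hR i)
    exact hp.eq_or_eq_of_mem_join hkl (this ▸ right_mem_join L (p i) (p j))
  have h₁ := key he.2 hf.2 he.1.ne hf.1.ne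
  have h₂ : e.2 = f.1 ∨ e.2 = f.2 → e.1 = f.1 ∨ e.1 = f.2 := by
    refine key ?_ hf.2 he.1.ne' hf.1.ne
    rw [join_comm (hp.1.ne he.1.ne')]
    exact he.2
  have := he.1
  have := hf.1
  obtain ⟨a, b⟩ := e
  obtain ⟨c, d⟩ := f
  simp only [EdgeDisjoint, ne_eq, Prod.mk.injEq] at *
  grind

open scoped Classical in
theorem IsArc.card_edgesThrough_le {n : ℕ} {p : Fin n → P} (hp : IsArc L p) {R : P}
    (hR : ∀ i, R ≠ p i) : 2 * #(edgesThrough L p R) ≤ n :=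
  card_le_of_edgeDisjoint (filter_subset _ _) fun _ he _ hf => hp.edgeDisjoint hR he hf

variable [Fintype P]

open scoped Classical in
/-- The points different from the entries of a tuple. -/
noncomputable def offPoints {n : ℕ} (p : Fin n → P) : Finset P := {R | ∀ i, R ≠ p i}

omit [Membership P L] [ProjectivePlane P L] in
theorem card_offPoints {n : ℕ} {p : Fin n → P} (hp : Function.Injective p) :
    (#(offPoints p) : ℤ) = Fintype.card P - n := by
  classical
  have : offPoints p = univ \ univ.image p := by
    ext R
    simp [offPoints, eq_comm]
  rw [this, cast_card_sdiff (subset_univ _), card_image_of_injective _ hp]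
  simp

open scoped Classical in
theorem card_offPoints_on_join [Finite L] {n : ℕ} {p : Fin n → P} (hp : IsArc L p)
    {e : Fin n × Fin n} (he : e ∈ edges n) :
    (#{R ∈ offPoints p | R ∈ join L (p e.1) (p e.2)} : ℤ) = ProjectivePlane.order P L - 1 := by
  have he' : e.1 ≠ e.2 := (mem_filter.1 he).2.ne
  have : {R ∈ offPoints p | R ∈ join L (p e.1) (p e.2)} =
      points (join L (p e.1) (p e.2)) \ {p e.1, p e.2} := by
    ext R
    simp only [offPoints, mem_filter, mem_univ, true_and, mem_sdiff, mem_points, mem_insert,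
      mem_singleton, not_or]
    constructor
    · exact fun h => ⟨h.2, h.1 _, h.1 _⟩
    · refine fun h => ⟨fun i hi => ?_, h.1⟩
      subst hi
      rcases hp.eq_or_eq_of_mem_join he' h.1 with rfl | rfl <;> simp at h
  rw [this, cast_card_sdiff, card_points_line, card_pair (hp.1.ne he')]
  · push_cast
    ring
  · intro R
    simp only [mem_insert, mem_singleton, mem_points]
    rintro (rfl | rfl)
    · exact left_mem_join _ _ _
    · exact right_mem_join _ _ _

open scoped Classical in
theorem card_offPoints_on_joins {n : ℕ} {p : Fin n → P} (hp : IsArc L p)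
    {T : Finset (Fin n × Fin n)} (hT : T ⊆ edges n) (hcard : 1 < #T) :
    #{R ∈ offPoints p | T ⊆ edgesThrough L p R} =
      if (∀ e ∈ T, ∀ f ∈ T, e ≠ f → EdgeDisjoint e f) ∧ Concurrent L p T then 1 else 0 := by
  obtain ⟨e, he, f, hf, hef⟩ := one_lt_card.1 hcard
  have hthrough : ∀ {R}, T ⊆ edgesThrough L p R ↔ ∀ e ∈ T, R ∈ join L (p e.1) (p e.2) := by
    intro R
    simp only [edgesThrough, subset_iff, mem_filter]
    exact ⟨fun h e he => (h he).2, fun h e he => ⟨hT he, h e he⟩⟩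
  split_ifs with h
  · obtain ⟨hdisj, X, hX⟩ := h
    have hd := hdisj e he f hf hef
    have he' : e.1 ≠ e.2 := (mem_filter.1 (hT he)).2.ne
    have hf' : f.1 ≠ f.2 := (mem_filter.1 (hT hf)).2.ne
    rw [card_eq_one]
    refine ⟨X, ?_⟩
    ext R
    simp only [offPoints, mem_filter, mem_univ, true_and, hthrough, mem_singleton]
    constructor
    · rintro ⟨-, hR⟩
      refine (Nondegenerate.eq_or_eq (hR e he) (hX e he) (hR f hf) (hX f hf)).resolve_right ?_
      intro hl
      have := hp.eq_or_eq_of_mem_join hf' (hl ▸ left_mem_join L (p e.1) (p e.2))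
      exact this.elim hd.1 hd.2.1
    · rintro rfl
      refine ⟨fun i hi => ?_, hX⟩
      subst hi
      have h₁ := hp.eq_or_eq_of_mem_join he' (hX e he)
      have h₂ := hp.eq_or_eq_of_mem_join hf' (hX f hf)
      simp only [EdgeDisjoint] at hd
      grind
  · rw [card_eq_zero, filter_eq_empty_iff]
    intro R hR hTR
    refine h ⟨fun e he f hf => hp.edgeDisjoint ?_ (hTR he) (hTR hf), R, hthrough.1 hTR⟩
    simpa [offPoints] using hR

open scoped Classical in
theorem sum_choose_card_edgesThrough {n k : ℕ} (hk : 1 < k) {p : Fin n → P} (hp : IsArc L p) :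
    ∑ R ∈ offPoints p, (#(edgesThrough L p R)).choose k =
      #{T ∈ matchings n k | Concurrent L p T} := by
  have h₁ : ∀ R, (#(edgesThrough L p R)).choose k =
      ∑ T ∈ powersetCard k (edges n), if T ⊆ edgesThrough L p R then 1 else 0 := by
    intro R
    rw [← card_powersetCard, ← card_filter]
    congr 1
    ext T
    simp only [mem_powersetCard, mem_filter]
    exact ⟨fun h => ⟨⟨h.1.trans (filter_subset _ _), h.2⟩, h.1⟩, fun h => ⟨h.2, h.1.2⟩⟩
  simp_rw [h₁]
  rw [sum_comm, matchings, filter_filter, card_filter]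
  refine sum_congr rfl fun T hT => ?_
  rw [mem_powersetCard] at hT
  rw [← card_filter, card_offPoints_on_joins hp hT.1 (hT.2 ▸ hk)]

open scoped Classical in
theorem card_extensions [Finite L] {n : ℕ} (hn : n ≤ 6) {p : Fin n → P} (hp : IsArc L p) :
    (#(extensions L p) : ℤ) = (ProjectivePlane.order P L : ℤ) ^ 2 + ProjectivePlane.order P L + 1
      - n - n.choose 2 * ((ProjectivePlane.order P L : ℤ) - 1) + 3 * n.choose 4
      - #{T ∈ matchings n 3 | Concurrent L p T} := by
  have hext : extensions L p = {R ∈ offPoints p | edgesThrough L p R = ∅} := by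
    ext R
    rw [mem_extensions hp]
    simp only [offPoints, mem_filter, mem_univ, true_and, edgesThrough, filter_eq_empty_iff, edges]
    refine and_congr_right fun _ => ⟨fun h e he => h _ _ he.ne, fun h i j hij hR => ?_⟩
    rcases hij.lt_or_gt with hlt | hlt
    · exact h (x := (i, j)) hlt hR
    · refine h (x := (j, i)) hlt ?_
      rwa [join_comm (hp.1.ne hij.symm)]
  have hind : ∀ R ∈ offPoints p, (if edgesThrough L p R = ∅ then 1 else 0 : ℤ) =
      1 - #(edgesThrough L p R) + (#(edgesThrough L p R)).choose 2
        - (#(edgesThrough L p R)).choose 3 := by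
    intro R hR
    have hle : #(edgesThrough L p R) ≤ 3 := by
      have := hp.card_edgesThrough_le (R := R) (by simpa [offPoints] using hR)
      omega
    simp only [← card_eq_zero]
    generalize #(edgesThrough L p R) = m at *
    interval_cases m <;> simp [Nat.choose]
  have hone : ∑ R ∈ offPoints p, (#(edgesThrough L p R) : ℤ) =
      n.choose 2 * ((ProjectivePlane.order P L : ℤ) - 1) := by
    rw [← card_edges hn, ← nsmul_eq_mul, ← sum_const,
      ← sum_congr rfl fun e he => card_offPoints_on_join hp he]
    simp only [edgesThrough, card_filter]
    push_cast
    exact sum_comm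
  have htwo : {T ∈ matchings n 2 | Concurrent L p T} = matchings n 2 := by
    refine filter_true_of_mem fun T hT => ?_
    simp only [matchings, mem_filter, mem_powersetCard] at hT
    obtain ⟨e, f, -, rfl⟩ := card_eq_two.1 hT.1.2
    obtain ⟨X, hX⟩ := exists_common_point (P := P) (join L (p e.1) (p e.2)) (join L (p f.1) (p f.2))
    exact ⟨X, by simpa using hX⟩
  rw [hext, card_filter]
  push_cast
  rw [sum_congr rfl hind]
  simp only [sum_sub_distrib, sum_add_distrib, sum_const, nsmul_eq_mul, mul_one, hone]
  rw [← Nat.cast_sum, ← Nat.cast_sum, sum_choose_card_edgesThrough one_lt_two hp,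
    sum_choose_card_edgesThrough (by norm_num) hp, htwo, card_matchings_two hn,
    card_offPoints hp.1, ProjectivePlane.card_points P L]
  push_cast
  ring

end Arcs

section Seven

variable {P L : Type*} [Membership P L] [ProjectivePlane P L]

theorem exists_perm_of_mem_matchings {T : Finset (Fin 6 × Fin 6)} (hT : T ∈ matchings 6 3) :
    ∃ σ : Equiv.Perm (Fin 6), T = {(σ 0, σ 1), (σ 2, σ 3), (σ 4, σ 5)} := by
  simp only [matchings, mem_filter, mem_powersetCard] at hT
  obtain ⟨⟨hsub, hcard⟩, hdisj⟩ := hT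
  obtain ⟨e, f, g, hef, heg, hfg, rfl⟩ := card_eq_three.1 hcard
  have he := (mem_filter.1 (hsub (show e ∈ _ by simp))).2.ne
  have hf := (mem_filter.1 (hsub (show f ∈ _ by simp))).2.ne
  have hg := (mem_filter.1 (hsub (show g ∈ _ by simp))).2.ne
  have h₁ := hdisj e (by simp) f (by simp) hef
  have h₂ := hdisj e (by simp) g (by simp) heg
  have h₃ := hdisj f (by simp) g (by simp) hfg
  simp only [EdgeDisjoint] at h₁ h₂ h₃
  have hinj : Function.Injective ![e.1, e.2, f.1, f.2, g.1, g.2] := by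
    intro i j hij
    fin_cases i <;> fin_cases j <;> simp at hij ⊢ <;> grind
  exact ⟨Equiv.ofBijective _ (Finite.injective_iff_bijective.1 hinj), rfl⟩

variable [Fintype P]

open scoped Classical in
theorem card_concurrent_eq {T : Finset (Fin 6 × Fin 6)} (hT : T ∈ matchings 6 3) :
    #{p ∈ arcs P L 6 | Concurrent L p T} =
      #{p ∈ arcs P L 6 | Concurrent L p {(0, 1), (2, 3), (4, 5)}} := by
  obtain ⟨σ, rfl⟩ := exists_perm_of_mem_matchings hT
  refine card_equiv (σ.symm.arrowCongr (Equiv.refl P)) fun p => ?_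
  have : IsArc L p ↔ IsArc L (p ∘ σ) :=
    ⟨fun h => h.comp σ.injective, fun h => by
      have h' := h.comp σ.symm.injective
      rwa [Function.comp_assoc, Equiv.self_comp_symm, Function.comp_id] at h'⟩
  simp only [mem_filter, mem_arcs]
  rw [this]
  simp [Concurrent, Equiv.arrowCongr, Function.comp_def]

theorem card_arcs_succ [Finite L] {n : ℕ} (hn : n ≤ 5) :
    (#(arcs P L (n + 1)) : ℤ) = #(arcs P L n) * ((ProjectivePlane.order P L : ℤ) ^ 2 +
      ProjectivePlane.order P L + 1 - n - n.choose 2 * ((ProjectivePlane.order P L : ℤ) - 1) +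
      3 * n.choose 4) := by
  have h := sum_arcs_succ (P := P) (L := L) (n := n) fun _ => 1
  simp only [sum_const, nsmul_eq_mul, mul_one] at h
  rw [h, ← nsmul_eq_mul, ← sum_const]
  refine sum_congr rfl fun p hp => ?_
  rw [card_extensions (hn.trans (by norm_num)) (mem_arcs.1 hp), matchings_three_eq_empty hn]
  simp

open scoped Classical in
theorem card_arcs_seven_eq_sub [Finite L] :
    (#(arcs P L 7) : ℤ) = #(arcs P L 6) * ((ProjectivePlane.order P L : ℤ) ^ 2 -
      14 * ProjectivePlane.order P L + 55) -
      15 * #{p ∈ arcs P L 6 | Concurrent L p {(0, 1), (2, 3), (4, 5)}} := by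
  have h := sum_arcs_succ (P := P) (L := L) (n := 6) fun _ => 1
  have hconc : ∑ p ∈ arcs P L 6, #{T ∈ matchings 6 3 | Concurrent L p T} =
      15 * #{p ∈ arcs P L 6 | Concurrent L p {(0, 1), (2, 3), (4, 5)}} := by
    rw [← card_matchings_six_three, ← smul_eq_mul, ← sum_const,
      ← sum_congr rfl fun T hT => card_concurrent_eq hT]
    simp only [card_filter]
    exact sum_comm
  simp only [sum_const, nsmul_eq_mul, mul_one] at h
  rw [h, sum_congr rfl fun p hp => card_extensions le_rfl (mem_arcs.1 hp), sum_sub_distrib,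
    ← Nat.cast_sum, hconc, sum_const, nsmul_eq_mul]
  rw [show Nat.choose 6 2 = 15 from rfl, show Nat.choose 6 4 = 15 from rfl]
  push_cast
  ring

variable (L) in
/-- The common point of the lines `p i p j` and `p k p l`. -/
noncomputable def diagonal {n : ℕ} (p : Fin n → P) (i j k l : Fin n) : P :=
  meet P (join L (p i) (p j)) (join L (p k) (p l))

omit [Fintype P] in
theorem diagonal_mem_left {n : ℕ} (p : Fin n → P) (i j k l : Fin n) :
    diagonal L p i j k l ∈ join L (p i) (p j) := meet_mem_left _ _

omit [Fintype P] in
theorem diagonal_mem_right {n : ℕ} (p : Fin n → P) (i j k l : Fin n) :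
    diagonal L p i j k l ∈ join L (p k) (p l) := meet_mem_right _ _

open scoped Classical in
theorem card_concurrent_extensions [Finite L] {p : Fin 5 → P} (hp : IsArc L p) :
    (#{R ∈ extensions L p |
      Concurrent L (Fin.cons R p : Fin 6 → P) {(0, 1), (2, 3), (4, 5)}} : ℤ) =
      ProjectivePlane.order P L - 5 +
      (if p 0 ∈ join L (diagonal L p 1 2 3 4) (diagonal L p 1 3 2 4) then 1 else 0) +
      if p 0 ∈ join L (diagonal L p 1 2 3 4) (diagonal L p 1 4 2 3) then 1 else 0 := by
  rw [← card_line_avoiding_pentagon (hp.2 1 2 3 (by decide) (by decide) (by decide))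
    (hp.2 1 2 4 (by decide) (by decide) (by decide))
    (hp.2 1 3 4 (by decide) (by decide) (by decide))
    (hp.2 2 3 4 (by decide) (by decide) (by decide))
    (hp.2 0 1 2 (by decide) (by decide) (by decide))
    (hp.2 0 1 3 (by decide) (by decide) (by decide))
    (hp.2 0 1 4 (by decide) (by decide) (by decide))
    (hp.2 0 2 3 (by decide) (by decide) (by decide))
    (hp.2 0 2 4 (by decide) (by decide) (by decide))
    (hp.2 0 3 4 (by decide) (by decide) (by decide))
    (diagonal_mem_left p 1 2 3 4) (diagonal_mem_right p 1 2 3 4)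
    (diagonal_mem_left p 1 3 2 4) (diagonal_mem_right p 1 3 2 4)
    (diagonal_mem_left p 1 4 2 3) (diagonal_mem_right p 1 4 2 3)]
  congr 2
  ext R
  simp only [mem_filter, mem_points]
  have hR : R ∈ extensions L p ↔ (R ∉ join L (p 1) (p 2) ∧ R ∉ join L (p 3) (p 4) ∧
      R ∉ join L (p 1) (p 3) ∧ R ∉ join L (p 2) (p 4) ∧ R ∉ join L (p 1) (p 4) ∧
      R ∉ join L (p 2) (p 3)) ∧ R ∉ join L (p 0) (p 1) ∧ R ∉ join L (p 0) (p 2) ∧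
      R ∉ join L (p 0) (p 3) ∧ R ∉ join L (p 0) (p 4) := by
    rw [mem_extensions_iff_lt (by norm_num) hp]
    simp [Fin.forall_fin_succ]
    tauto
  rw [← hR, and_comm]
  refine and_congr_left fun hR => ?_
  have hR0 : R ≠ p 0 := (mem_extensions hp).1 hR |>.1 0
  have hD₁ := diagonal_mem_left (L := L) p 1 2 3 4
  have hD₂ := diagonal_mem_right (L := L) p 1 2 3 4
  generalize diagonal L p 1 2 3 4 = D at *
  have hD0 : D ≠ p 0 := by
    rintro rfl
    simpa using hp.eq_or_eq_of_mem_join (by decide) hD₁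
  have hl : join L (p 1) (p 2) ≠ join L (p 3) (p 4) := by
    intro h
    have := hp.eq_or_eq_of_mem_join (by decide) (h ▸ left_mem_join L (p 1) (p 2))
    revert this
    decide
  have hiff : Concurrent L (Fin.cons R p : Fin 6 → P) {(0, 1), (2, 3), (4, 5)} ↔
      D ∈ join L R (p 0) := by
    have : Concurrent L (Fin.cons R p : Fin 6 → P) {(0, 1), (2, 3), (4, 5)} ↔
        ∃ X, X ∈ join L R (p 0) ∧ X ∈ join L (p 1) (p 2) ∧ X ∈ join L (p 3) (p 4) := by
      simp [Concurrent]
      rfl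
    rw [this]
    refine ⟨fun ⟨X, h₀, h₁, h₂⟩ => ?_, fun h => ⟨D, h, hD₁, hD₂⟩⟩
    rwa [← (Nondegenerate.eq_or_eq h₁ hD₁ h₂ hD₂).resolve_right hl]
  rw [hiff]
  constructor
  · intro h
    rw [← eq_join hD0 h (right_mem_join L _ _)]
    exact left_mem_join L _ _
  · intro h
    rw [← eq_join hR0 h (right_mem_join L _ _)]
    exact left_mem_join L _ _

open scoped Classical in
theorem card_extensions_on_diagonal [Finite L] {p : Fin 4 → P} (hp : IsArc L p) :
    (#{R ∈ extensions L p | R ∈ join L (diagonal L p 0 1 2 3) (diagonal L p 0 2 1 3)} : ℤ) =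
      ProjectivePlane.order P L - 3 +
      if diagonal L p 0 3 1 2 ∈ join L (diagonal L p 0 1 2 3) (diagonal L p 0 2 1 3)
        then 1 else 0 := by
  rw [← card_line_avoiding_quadrangle (hp.2 0 1 2 (by decide) (by decide) (by decide))
    (hp.2 0 1 3 (by decide) (by decide) (by decide))
    (hp.2 0 2 3 (by decide) (by decide) (by decide))
    (hp.2 1 2 3 (by decide) (by decide) (by decide))
    (diagonal_mem_left p 0 1 2 3) (diagonal_mem_right p 0 1 2 3)
    (diagonal_mem_left p 0 2 1 3) (diagonal_mem_right p 0 2 1 3)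
    (diagonal_mem_left p 0 3 1 2) (diagonal_mem_right p 0 3 1 2)]
  congr 2
  ext R
  simp only [mem_filter, mem_points]
  rw [mem_extensions_iff_lt (by norm_num) hp]
  simp [Fin.forall_fin_succ]
  tauto

end Seven

section Count

variable {P L : Type*} [Membership P L] [ProjectivePlane P L]

variable (L) in
/-- The three diagonal points of a quadrangle are collinear. -/
def IsFano (p : Fin 4 → P) : Prop :=
  diagonal L p 0 3 1 2 ∈ join L (diagonal L p 0 1 2 3) (diagonal L p 0 2 1 3)

theorem IsArc.diagonal_ne {p : Fin 4 → P} (hp : IsArc L p) {i j k l : Fin 4}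
    (h : [i, j, k, l].Nodup) : diagonal L p i j k l ≠ diagonal L p i k j l := by
  simp only [List.nodup_cons, List.mem_cons, not_or] at h
  intro heq
  have h₁ := diagonal_mem_left (L := L) p i j k l
  have h₂ := diagonal_mem_right (L := L) p i j k l
  have h₃ := diagonal_mem_left (L := L) p i k j l
  rw [← heq] at h₃
  have hjk : join L (p i) (p j) ≠ join L (p i) (p k) := fun h' => by
    have := hp.eq_or_eq_of_mem_join (by grind) (h' ▸ right_mem_join L (p i) (p j))
    grind
  have hD := (Nondegenerate.eq_or_eq h₁ (left_mem_join L (p i) (p j)) h₃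
    (left_mem_join L (p i) (p k))).resolve_right hjk
  have := hp.eq_or_eq_of_mem_join (by grind) (hD ▸ h₂)
  grind

theorem diagonal_swap_right {n : ℕ} {p : Fin n → P} (hp : IsArc L p) {i j k l : Fin n}
    (h : k ≠ l) : diagonal L p i j k l = diagonal L p i j l k := by
  rw [diagonal, join_comm (hp.1.ne h), diagonal]

variable [Fintype P] [Finite L]

open scoped Classical in
theorem card_extensions_on_diagonal_isFano {p : Fin 4 → P} (hp : IsArc L p) :
    (#{R ∈ extensions L p | R ∈ join L (diagonal L p 0 1 2 3) (diagonal L p 0 3 1 2)} : ℤ) =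
      ProjectivePlane.order P L - 3 + if IsFano L p then 1 else 0 := by
  let σ : Equiv.Perm (Fin 4) := Equiv.swap 2 3
  have hext : extensions L p = extensions L (p ∘ σ) := by
    ext R
    rw [mem_extensions hp, mem_extensions (hp.comp σ.injective)]
    exact ⟨fun h => ⟨fun _ => h.1 _, fun _ _ hij => h.2 _ _ (σ.injective.ne hij)⟩,
      fun h => ⟨fun i => by simpa using h.1 (σ.symm i), fun i j hij => by
        simpa using h.2 (σ.symm i) (σ.symm j) (σ.symm.injective.ne hij)⟩⟩
  have h := card_extensions_on_diagonal (hp.comp σ.injective)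
  have hD : diagonal L (p ∘ σ) 0 1 2 3 = diagonal L p 0 1 2 3 :=
    (diagonal_swap_right hp (by decide))
  have hE : diagonal L (p ∘ σ) 0 2 1 3 = diagonal L p 0 3 1 2 := rfl
  have hF : diagonal L (p ∘ σ) 0 3 1 2 = diagonal L p 0 2 1 3 := rfl
  rw [hD, hE, hF, ← hext] at h
  rw [h, IsFano]
  have hDE := hp.diagonal_ne (i := 0) (j := 1) (k := 2) (l := 3) (by decide)
  have hDF : diagonal L p 0 1 2 3 ≠ diagonal L p 0 3 1 2 := by
    rw [diagonal_swap_right hp (by decide)]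
    exact hp.diagonal_ne (by decide)
  have hiff : diagonal L p 0 2 1 3 ∈ join L (diagonal L p 0 1 2 3) (diagonal L p 0 3 1 2) ↔
      diagonal L p 0 3 1 2 ∈ join L (diagonal L p 0 1 2 3) (diagonal L p 0 2 1 3) := by
    constructor <;> intro h
    · rw [← eq_join hDE (left_mem_join L _ _) h]
      exact right_mem_join L _ _
    · rw [← eq_join hDF (left_mem_join L _ _) h]
      exact right_mem_join L _ _
  simp only [hiff]

/-- The number of ordered 7-arcs in terms of the number of quadrangles with collinear diagonal
points. -/
theorem card_arcs_seven (c : Prop) [Decidable c]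
    (hc : ∀ p : Fin 4 → P, IsArc L p → (IsFano L p ↔ c)) (q : ℤ)
    (hq : q = ProjectivePlane.order P L) :
    (#(arcs P L 7) : ℤ) = (q ^ 2 + q + 1) * (q ^ 2 + q) * q ^ 2 * (q - 1) ^ 2 *
      ((q - 3) * (q - 5) * (q ^ 4 - 20 * q ^ 3 + 148 * q ^ 2 - 468 * q + 498) -
        30 * if c then 1 else 0) := by
  classical
  have c₀ : (#(arcs P L 0) : ℤ) = 1 := by
    rw [Nat.cast_eq_one, card_eq_one]
    refine ⟨Fin.elim0, ?_⟩
    ext p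
    simp only [mem_arcs, mem_singleton, Subsingleton.elim p Fin.elim0, iff_true]
    exact ⟨fun i => i.elim0, fun i => i.elim0⟩
  have c₁ := card_arcs_succ (P := P) (L := L) (n := 0) (by norm_num)
  have c₂ := card_arcs_succ (P := P) (L := L) (n := 1) (by norm_num)
  have c₃ := card_arcs_succ (P := P) (L := L) (n := 2) (by norm_num)
  have c₄ := card_arcs_succ (P := P) (L := L) (n := 3) (by norm_num)
  have c₅ := card_arcs_succ (P := P) (L := L) (n := 4) (by norm_num)
  have c₆ := card_arcs_succ (P := P) (L := L) (n := 5) (by norm_num)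
  have c₇ := card_arcs_seven_eq_sub (P := P) (L := L)
  have hM₁ : ∑ p ∈ arcs P L 5,
      (if p 0 ∈ join L (diagonal L p 1 2 3 4) (diagonal L p 1 3 2 4) then 1 else 0 : ℤ) =
      #(arcs P L 4) * (q - 3 + if c then 1 else 0) := by
    rw [sum_arcs_succ, ← nsmul_eq_mul, ← sum_const]
    refine sum_congr rfl fun p hp => ?_
    rw [mem_arcs] at hp
    have h := card_extensions_on_diagonal hp
    simp only [← hc p hp, IsFano, hq, ← h, ← sum_boole]
    rfl
  have hM₂ : ∑ p ∈ arcs P L 5,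
      (if p 0 ∈ join L (diagonal L p 1 2 3 4) (diagonal L p 1 4 2 3) then 1 else 0 : ℤ) =
      #(arcs P L 4) * (q - 3 + if c then 1 else 0) := by
    rw [sum_arcs_succ, ← nsmul_eq_mul, ← sum_const]
    refine sum_congr rfl fun p hp => ?_
    rw [mem_arcs] at hp
    have h := card_extensions_on_diagonal_isFano hp
    simp only [← hc p hp, hq, ← h, ← sum_boole]
    rfl
  have hK : (#{p ∈ arcs P L 6 | Concurrent L p {(0, 1), (2, 3), (4, 5)}} : ℤ) =
      #(arcs P L 5) * (q - 5) + 2 * (#(arcs P L 4) * (q - 3 + if c then 1 else 0)) := by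
    rw [← sum_boole, sum_arcs_succ, two_mul, ← add_assoc]
    nth_rw 1 [← hM₁]
    rw [← hM₂, ← nsmul_eq_mul, ← sum_const, ← sum_add_distrib, ← sum_add_distrib]
    refine sum_congr rfl fun p hp => ?_
    rw [sum_boole, card_concurrent_extensions (mem_arcs.1 hp), hq]
  simp only [show Nat.choose 0 2 = 0 from rfl, show Nat.choose 1 2 = 0 from rfl,
    show Nat.choose 2 2 = 1 from rfl, show Nat.choose 3 2 = 3 from rfl,
    show Nat.choose 4 2 = 6 from rfl, show Nat.choose 5 2 = 10 from rfl,
    show Nat.choose 0 4 = 0 from rfl, show Nat.choose 1 4 = 0 from rfl,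
    show Nat.choose 2 4 = 0 from rfl, show Nat.choose 3 4 = 0 from rfl,
    show Nat.choose 4 4 = 1 from rfl, show Nat.choose 5 4 = 5 from rfl, Nat.reduceAdd,
    ← hq] at c₁ c₂ c₃ c₄ c₅ c₆ c₇
  push_cast at c₁ c₂ c₃ c₄ c₅ c₆
  rw [c₇, hK, c₆, c₅, c₄, c₃, c₂, c₁, c₀]
  split_ifs <;> ring

end Count

section Field

open Projectivization Matrix
open scoped LinearAlgebra.Projectivization

variable {F : Type*} [Field F]

theorem mem_iff_rep {x l : ℙ F (Fin 3 → F)} : x ∈ l ↔ x.rep ⬝ᵥ l.rep = 0 := by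
  rw [ofField.mem_iff, ← orthogonal_mk x.rep_nonzero l.rep_nonzero, mk_rep, mk_rep]

theorem mk_mem_iff {v : Fin 3 → F} (hv : v ≠ 0) {l : ℙ F (Fin 3 → F)} :
    mk F v hv ∈ l ↔ v ⬝ᵥ l.rep = 0 := by
  rw [ofField.mem_iff, ← orthogonal_mk hv l.rep_nonzero, mk_rep]

theorem mem_mk_iff {w : Fin 3 → F} (hw : w ≠ 0) {x : ℙ F (Fin 3 → F)} :
    x ∈ mk F w hw ↔ x.rep ⬝ᵥ w = 0 := by
  rw [ofField.mem_iff, ← orthogonal_mk x.rep_nonzero hw, mk_rep]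

theorem nonCollinear_iff_linearIndependent {x y z : ℙ F (Fin 3 → F)} :
    NonCollinear (ℙ F (Fin 3 → F)) x y z ↔ LinearIndependent F ![x.rep, y.rep, z.rep] := by
  have h := exists_mulVec_eq_zero_iff (M := Matrix.of ![x.rep, y.rep, z.rep])
  have h' := linearIndependent_rows_iff_isUnit (A := Matrix.of ![x.rep, y.rep, z.rep])
  rw [isUnit_iff_isUnit_det, isUnit_iff_ne_zero, ne_eq, ← h] at h'
  refine Iff.trans ?_ h'.symm
  have hw : ∀ w : Fin 3 → F, Matrix.of ![x.rep, y.rep, z.rep] *ᵥ w = 0 ↔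
      x.rep ⬝ᵥ w = 0 ∧ y.rep ⬝ᵥ w = 0 ∧ z.rep ⬝ᵥ w = 0 := by
    intro w
    simp [funext_iff, Fin.forall_fin_succ]
  simp only [hw, NonCollinear]
  constructor
  · rintro hl ⟨w, hw0, hx, hy, hz⟩
    exact hl (mk F w hw0) ((mem_mk_iff hw0).2 hx) ((mem_mk_iff hw0).2 hy) ((mem_mk_iff hw0).2 hz)
  · intro hl l hx hy hz
    exact hl ⟨l.rep, l.rep_nonzero, mem_iff_rep.1 hx, mem_iff_rep.1 hy, mem_iff_rep.1 hz⟩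

variable [DecidableEq F]

theorem diagonal_mem_iff {p : Fin 4 → ℙ F (Fin 3 → F)} (hp : IsArc (ℙ F (Fin 3 → F)) p)
    {i j k l : Fin 4} (h : [i, j, k, l].Nodup) {a b c : F}
    (hl : (p l).rep = a • (p i).rep + b • (p j).rep + c • (p k).rep) {m : ℙ F (Fin 3 → F)} :
    diagonal (ℙ F (Fin 3 → F)) p i j k l ∈ m ↔
      a * ((p i).rep ⬝ᵥ m.rep) + b * ((p j).rep ⬝ᵥ m.rep) = 0 := by
  simp only [List.nodup_cons, List.mem_cons, not_or] at h
  have hv : a • (p i).rep + b • (p j).rep ≠ 0 := by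
    intro h0
    rw [h0, zero_add] at hl
    refine hp.2 i k l (by grind) (by grind) (by grind) (join _ (p i) (p k))
      (left_mem_join _ _ _) (right_mem_join _ _ _) ?_
    rw [mem_iff_rep, hl, smul_dotProduct, mem_iff_rep.1 (right_mem_join _ _ _), smul_zero]
  have hD : mk F _ hv = diagonal (ℙ F (Fin 3 → F)) p i j k l := by
    refine eq_meet (fun h' => ?_) ?_ ?_
    · have := hp.eq_or_eq_of_mem_join (by grind) (h' ▸ left_mem_join _ (p i) (p j))
      grind
    · rw [mk_mem_iff, add_dotProduct, smul_dotProduct, smul_dotProduct,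
        mem_iff_rep.1 (left_mem_join _ _ _), mem_iff_rep.1 (right_mem_join _ _ _)]
      simp
    · rw [mk_mem_iff, ← sub_eq_iff_eq_add.2 hl, sub_dotProduct, smul_dotProduct,
        mem_iff_rep.1 (left_mem_join _ _ _), mem_iff_rep.1 (right_mem_join _ _ _)]
      simp
  rw [← hD, mk_mem_iff, add_dotProduct, smul_dotProduct, smul_dotProduct, smul_eq_mul, smul_eq_mul]

theorem IsArc.coeff_ne_zero {p : Fin 4 → ℙ F (Fin 3 → F)} (hp : IsArc (ℙ F (Fin 3 → F)) p)
    {i j k l : Fin 4} (h : [i, j, k, l].Nodup) {a b c : F}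
    (hl : (p l).rep = a • (p i).rep + b • (p j).rep + c • (p k).rep) : c ≠ 0 := by
  rintro rfl
  simp only [List.nodup_cons, List.mem_cons, not_or] at h
  refine hp.2 i j l (by grind) (by grind) (by grind) (join _ (p i) (p j))
    (left_mem_join _ _ _) (right_mem_join _ _ _) ?_
  rw [mem_iff_rep, hl, add_dotProduct, add_dotProduct, smul_dotProduct, smul_dotProduct,
    mem_iff_rep.1 (left_mem_join _ _ _), mem_iff_rep.1 (right_mem_join _ _ _)]
  simp

theorem isFano_iff {p : Fin 4 → ℙ F (Fin 3 → F)} (hp : IsArc (ℙ F (Fin 3 → F)) p) :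
    IsFano (ℙ F (Fin 3 → F)) p ↔ (2 : F) = 0 := by
  have hli := nonCollinear_iff_linearIndependent.1
    (hp.2 0 1 2 (by decide) (by decide) (by decide))
  let B := basisOfLinearIndependentOfCardEqFinrank hli (by simp)
  obtain ⟨a, b, c, h⟩ : ∃ a b c : F,
      (p 3).rep = a • (p 0).rep + b • (p 1).rep + c • (p 2).rep := by
    refine ⟨B.repr (p 3).rep 0, B.repr (p 3).rep 1, B.repr (p 3).rep 2, ?_⟩
    conv_lhs => rw [← B.sum_repr (p 3).rep]
    simp [Fin.sum_univ_three, B]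
  have hc := hp.coeff_ne_zero (by decide) h
  have hb := hp.coeff_ne_zero (i := 0) (j := 2) (k := 1) (l := 3) (by decide)
    (h.trans (add_right_comm _ _ _))
  have ha := hp.coeff_ne_zero (i := 2) (j := 1) (k := 0) (l := 3) (a := c) (b := b) (c := a)
    (by decide) (by rw [h]; abel)
  have hD := @diagonal_mem_iff F _ _ p hp 0 1 2 3 (by decide) a b c h
  have hE := @diagonal_mem_iff F _ _ p hp 0 2 1 3 (by decide) a c b
    (h.trans (add_right_comm _ _ _))
  have hF := @diagonal_mem_iff F _ _ p hp 0 3 1 2 (by decide) (-(c⁻¹ * a)) c⁻¹ (-(c⁻¹ * b))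
    (by rw [h]; ext t; simp; field_simp; ring)
  rw [IsFano]
  have hDm := hD.1 (left_mem_join (ℙ F (Fin 3 → F)) (diagonal (ℙ F (Fin 3 → F)) p 0 1 2 3)
    (diagonal (ℙ F (Fin 3 → F)) p 0 2 1 3))
  have hEm := hE.1 (right_mem_join (ℙ F (Fin 3 → F)) (diagonal (ℙ F (Fin 3 → F)) p 0 1 2 3)
    (diagonal (ℙ F (Fin 3 → F)) p 0 2 1 3))
  set m := join (ℙ F (Fin 3 → F)) (diagonal (ℙ F (Fin 3 → F)) p 0 1 2 3)
    (diagonal (ℙ F (Fin 3 → F)) p 0 2 1 3)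
  have hnc := hp.2 0 1 2 (by decide) (by decide) (by decide) m
  simp only [mem_iff_rep] at hnc
  have h3 : (p 3).rep ⬝ᵥ m.rep = a * ((p 0).rep ⬝ᵥ m.rep) + b * ((p 1).rep ⬝ᵥ m.rep) +
      c * ((p 2).rep ⬝ᵥ m.rep) := by
    rw [h]; simp
  rw [hF, h3]
  have hF' : -(c⁻¹ * a) * ((p 0).rep ⬝ᵥ m.rep) + c⁻¹ * (a * ((p 0).rep ⬝ᵥ m.rep) +
      b * ((p 1).rep ⬝ᵥ m.rep) + c * ((p 2).rep ⬝ᵥ m.rep)) = 0 ↔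
      b * ((p 1).rep ⬝ᵥ m.rep) + c * ((p 2).rep ⬝ᵥ m.rep) = 0 := by
    rw [show -(c⁻¹ * a) * ((p 0).rep ⬝ᵥ m.rep) + c⁻¹ * (a * ((p 0).rep ⬝ᵥ m.rep) +
      b * ((p 1).rep ⬝ᵥ m.rep) + c * ((p 2).rep ⬝ᵥ m.rep)) =
      c⁻¹ * (b * ((p 1).rep ⬝ᵥ m.rep) + c * ((p 2).rep ⬝ᵥ m.rep)) by ring]
    simp [hc]
  rw [hF']
  generalize (p 0).rep ⬝ᵥ m.rep = α at *
  generalize (p 1).rep ⬝ᵥ m.rep = β at *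
  generalize (p 2).rep ⬝ᵥ m.rep = γ at *
  constructor
  · intro hFm
    by_contra h2
    have e₁ : 2 * (a * α) = 0 := by linear_combination hDm + hEm - hFm
    have e₂ : 2 * (b * β) = 0 := by linear_combination hDm + hFm - hEm
    have e₃ : 2 * (c * γ) = 0 := by linear_combination hEm + hFm - hDm
    simp_all
  · intro h2
    linear_combination hDm + hEm - a * α * h2

omit [DecidableEq F] in
theorem two_eq_zero_iff_dvd_card [Fintype F] : (2 : F) = 0 ↔ 2 ∣ Fintype.card F := by
  constructor
  · intro h
    have : CharP F 2 := CharTwo.of_one_ne_zero_of_two_eq_zero one_ne_zero h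
    obtain ⟨n, -, hn⟩ := FiniteField.card F 2
    rw [hn]
    exact dvd_pow_self 2 n.ne_zero
  · intro h
    obtain ⟨p, hp⟩ := CharP.exists F
    obtain ⟨n, hprime, hn⟩ := FiniteField.card F p
    rw [hn] at h
    obtain rfl := (Nat.prime_dvd_prime_iff_eq Nat.prime_two hprime).1
      (Nat.prime_two.dvd_of_dvd_pow h)
    exact_mod_cast CharP.cast_eq_zero F 2

theorem order_eq_card [Fintype F] :
    ProjectivePlane.order (ℙ F (Fin 3 → F)) (ℙ F (Fin 3 → F)) = Fintype.card F := by
  classical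
  have : Fintype (ℙ F (Fin 3 → F)) := Fintype.ofFinite _
  have h := ProjectivePlane.card_points (ℙ F (Fin 3 → F)) (ℙ F (Fin 3 → F))
  have h' := card_of_finrank F (Fin 3 → F) (n := 3) (by simp)
  rw [← Nat.card_eq_fintype_card, h'] at h
  simp only [sum_range_succ, range_zero, sum_empty, Nat.card_eq_fintype_card] at h
  nlinarith

end Field

theorem p2nArcs_eq_card_arcs {F : Type} [Field F]
    [Fintype (Projectivization F (Fin 3 → F))] (n : ℕ) :
    P2nArcs F n =
      #(arcs (Projectivization F (Fin 3 → F)) (Projectivization F (Fin 3 → F)) n) := by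
  classical
  rw [P2nArcs, Nat.card_eq_fintype_card, Fintype.card_subtype, arcs]
  congr 1
  ext p
  simp only [mem_filter, mem_univ, true_and, IsArc, P2Collinear, not_not,
    Projectivization.independent_iff, nonCollinear_iff_linearIndependent]
  have : ∀ x y z : Projectivization F (Fin 3 → F),
      Projectivization.rep ∘ ![x, y, z] = ![x.rep, y.rep, z.rep] := by
    intro x y z
    ext i : 1
    fin_cases i <;> rfl
  simp only [this]

end PlaneArcs

/-- The quasipolynomial (period 2) formula for the number of ordered 7-arcs in
`ℙ²(F_q)`: `C₇(q) = (q²+q+1)(q²+q)q²(q−1)²·[(q−3)(q−5)(q⁴−20q³+148q²−468q+498) − 30·a(q)]`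
where `a(q) = 1` if `q` is even and `0` if `q` is odd. -/
theorem count_seven_arcs_desarguesian (F : Type) [Field F] [Fintype F]
    (q a : ℤ) (hq : q = Fintype.card F)
    (ha : a = if 2 ∣ Fintype.card F then 1 else 0) :
    (P2nArcs F 7 : ℤ) =
      (q ^ 2 + q + 1) * (q ^ 2 + q) * q ^ 2 * (q - 1) ^ 2 *
        ((q - 3) * (q - 5) * (q ^ 4 - 20 * q ^ 3 + 148 * q ^ 2 - 468 * q + 498)
          - 30 * a) := by
  classical
  have : Fintype (Projectivization F (Fin 3 → F)) := Fintype.ofFinite _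
  rw [PlaneArcs.p2nArcs_eq_card_arcs, ha]
  exact PlaneArcs.card_arcs_seven _
    (fun p hp => (PlaneArcs.isFano_iff hp).trans PlaneArcs.two_eq_zero_iff_dvd_card) q
    (by rw [hq, PlaneArcs.order_eq_card])
end
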